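/- arXiv:math/0508214 — 6 statements merged into one kernel-verified Lean document; each statement's English description precedes it below -/
import Mathlib

section
/- Let R be a commutative Noetherian ring of prime characteristic p, let G be an R-module equipped with a Frobenius-semilinear endomorphism ξ, and suppose G is x-torsion-free. Let 𝔠 be an ideal of R and let w₀ ∈ ℕ. If c·ξⁿ(g) = 0 for every c ∈ 𝔠, every g ∈ G and every n ≥ w₀, then a·ξⁿ(g) = 0 for every a in the radical √𝔠, every g ∈ G and every n ∈ ℕ. -/
theorem iterate_smul_of_semilinear {R G : Type*} [CommRing R] [AddCommGroup G] [Module R G]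
    {p : ℕ} {ξ : G → G} (hsemi : ∀ (r : R) (g : G), ξ (r • g) = r ^ p • ξ g)
    (r : R) (g : G) (j : ℕ) : ξ^[j] (r • g) = r ^ p ^ j • ξ^[j] g := by
  induction j with
  | zero => simp
  | succ j ih => rw [Function.iterate_succ_apply', ih, hsemi, Function.iterate_succ_apply',
      ← pow_mul, ← pow_succ]

/-- Let `R` be a commutative Noetherian ring of prime characteristic `p`,
let `G` be an `R`-module equipped with a Frobenius-semilinear endomorphism `ξ`, and
suppose `G` is `x`-torsion-free.  Let `𝔠` be an ideal of `R` and `w₀ ∈ ℕ`.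
If `c • ξⁿ g = 0` for every `c ∈ 𝔠`, every `g ∈ G` and every `n ≥ w₀`, then
`a • ξⁿ g = 0` for every `a ∈ √𝔠`, every `g ∈ G` and every `n ∈ ℕ`. -/
theorem stmt0 (R : Type*) [CommRing R] [IsNoetherianRing R]
    (p : ℕ) (hp : p.Prime) [CharP R p]
    (G : Type*) [AddCommGroup G] [Module R G]
    (ξ : G → G)
    (hadd : ∀ a b : G, ξ (a + b) = ξ a + ξ b)
    (hsemi : ∀ (r : R) (g : G), ξ (r • g) = r ^ p • ξ g)
    (htf : ∀ g : G, (∃ j : ℕ, 0 < j ∧ ξ^[j] g = 0) → g = 0)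
    (𝔠 : Ideal R) (w₀ : ℕ)
    (h0 : ∀ c ∈ 𝔠, ∀ g : G, ∀ n : ℕ, w₀ ≤ n → c • ξ^[n] g = 0) :
    ∀ a ∈ 𝔠.radical, ∀ g : G, ∀ n : ℕ, a • ξ^[n] g = 0 := by
  rintro a ⟨k, hk⟩ g n
  refine htf _ ⟨k + w₀ + 1, by omega, ?_⟩
  have hle : k ≤ p ^ (k + w₀ + 1) := by
    have := Nat.lt_pow_self (n := k + w₀ + 1) hp.one_lt
    omega
  rw [iterate_smul_of_semilinear hsemi, ← Function.iterate_add_apply]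
  exact h0 _ (𝔠.pow_mem_of_pow_mem hk hle) g _ (by omega)
end

section
/- Let (R,𝔪) be a local commutative Noetherian ring of prime characteristic p, and let H be an R-module which is Artinian and which carries a Frobenius-semilinear endomorphism ξ. Then there exists e ∈ ℕ such that ξ^e(h) = 0 for every h ∈ Γ_x(H), i.e., ξ^e annihilates every element of H that is killed by some power of ξ. -/
namespace HartshorneSpeiserLyubeznik

/-- An endomorphism that agrees with a scalar on every finite set. -/
def IsLocallyScalar {R H : Type*} [CommRing R] [AddCommGroup H] [Module R H]
    (φ : Module.End R H) : Prop :=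
  ∀ T : Finset H, ∃ r : R, ∀ h ∈ T, φ h = r • h

section LocallyScalar

variable {R H : Type*} [CommRing R] [AddCommGroup H] [Module R H]

theorem isLocallyScalar_one : IsLocallyScalar (1 : Module.End R H) :=
  fun _ => ⟨1, by simp⟩

theorem IsLocallyScalar.mul {φ ψ : Module.End R H} (hφ : IsLocallyScalar φ)
    (hψ : IsLocallyScalar ψ) : IsLocallyScalar (φ * ψ) := by
  intro T
  obtain ⟨r, hr⟩ := hφ T
  obtain ⟨t, ht⟩ := hψ T
  refine ⟨t * r, fun h hh => ?_⟩
  rw [Module.End.mul_apply, ht h hh, map_smul, hr h hh, smul_smul]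

theorem IsLocallyScalar.pow {φ : Module.End R H} (hφ : IsLocallyScalar φ) (n : ℕ) :
    IsLocallyScalar (φ ^ n) := by
  induction n with
  | zero => simpa using isLocallyScalar_one
  | succ n ih => rw [pow_succ]; exact ih.mul hφ

theorem IsLocallyScalar.apply_mem {φ : Module.End R H} (hφ : IsLocallyScalar φ)
    {N : Submodule R H} {h : H} (hh : h ∈ N) : φ h ∈ N := by
  obtain ⟨r, hr⟩ := hφ {h}
  rw [hr h (by simp)]
  exact N.smul_mem r hh

theorem IsLocallyScalar.commute {φ ψ : Module.End R H} (hψ : IsLocallyScalar ψ) :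
    φ * ψ = ψ * φ := by
  classical
  ext h
  obtain ⟨t, ht⟩ := hψ {h, φ h}
  simp only [Module.End.mul_apply]
  rw [ht h (by simp), ht (φ h) (by simp), map_smul]

theorem IsLocallyScalar.semilinear {φ : Module.End R H} (hφ : IsLocallyScalar φ) {p : ℕ}
    {ξ : H → H} (hsemi : ∀ (r : R) (h : H), ξ (r • h) = r ^ p • ξ h) (h : H) :
    ξ (φ h) = (φ ^ p) (ξ h) := by
  classical
  obtain ⟨r, hr⟩ := hφ {h, ξ h}
  have key : ∀ n : ℕ, (φ ^ n) (ξ h) = r ^ n • ξ h := by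
    intro n
    induction n with
    | zero => simp
    | succ n ih =>
      rw [pow_succ', Module.End.mul_apply, ih, map_smul, hr (ξ h) (by simp), smul_smul, pow_succ]
  rw [hr h (by simp), hsemi, key]

/-- Finitely solvable systems of conditions `r • h - v ∈ L` on a scalar `r`, with values in an
Artinian module, are solved by a locally scalar endomorphism. -/
theorem exists_isLocallyScalar_of_finitely_solvable [IsArtinian R H]
    (G₀ : Set (H × H × Submodule R H))
    (hG₀ : ∀ F : Finset (H × H × Submodule R H), ↑F ⊆ G₀ →
      ∃ r : R, ∀ c ∈ F, r • c.1 - c.2.1 ∈ c.2.2) :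
    ∃ φ : Module.End R H, IsLocallyScalar φ ∧ ∀ c ∈ G₀, φ c.1 - c.2.1 ∈ c.2.2 := by
  classical
  obtain ⟨G, hG₀G, hGmax⟩ := zorn_subset_nonempty
    {G : Set (H × H × Submodule R H) | ∀ F : Finset (H × H × Submodule R H), ↑F ⊆ G →
      ∃ r : R, ∀ c ∈ F, r • c.1 - c.2.1 ∈ c.2.2}
    (by
      intro C hC hchain hne
      refine ⟨⋃₀ C, fun F hF => ?_, fun s hs => Set.subset_sUnion_of_mem hs⟩
      obtain ⟨s, hs, hFs⟩ := hchain.directedOn.exists_mem_subset_of_finset_subset_biUnion hne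
        (s := F) (f := id) (by simpa [Set.sUnion_eq_biUnion] using hF)
      exact hC hs F hFs) G₀ hG₀
  have hG := hGmax.prop
  have htot : ∀ h : H, ∃ v : H, (h, v, (⊥ : Submodule R H)) ∈ G := by
    intro h
    let D : Finset (H × H × Submodule R H) → Submodule R R := fun F =>
      ⨅ c ∈ F, c.2.2.comap (LinearMap.toSpanSingleton R H c.1)
    let W : Finset (H × H × Submodule R H) → Submodule R H := fun F =>
      (D F).map (LinearMap.toSpanSingleton R H h)
    have hD : ∀ F r, r ∈ D F ↔ ∀ c ∈ F, r • c.1 ∈ c.2.2 := by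
      intro F r
      simp [D, Submodule.mem_iInf]
    obtain ⟨_, ⟨F₀, hF₀, rfl⟩, hmin⟩ := (wellFounded_lt (α := Submodule R H)).has_min
      (W '' {F | ↑F ⊆ G}) ⟨W ∅, ∅, by simp, rfl⟩
    obtain ⟨r₀, hr₀⟩ := hG F₀ hF₀
    refine ⟨r₀ • h, ?_⟩
    have hext : ∀ F : Finset (H × H × Submodule R H), ↑F ⊆ G →
        ∃ r : R, (∀ c ∈ F, r • c.1 - c.2.1 ∈ c.2.2) ∧ r • h = r₀ • h := by
      intro F hF
      have hU : (↑(F ∪ F₀) : Set (H × H × Submodule R H)) ⊆ G := by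
        simpa using ⟨hF, hF₀⟩
      obtain ⟨r₁, hr₁⟩ := hG _ hU
      have hle : W (F ∪ F₀) ≤ W F₀ := Submodule.map_mono fun r hr =>
        (hD _ _).2 fun c hc => (hD _ _).1 hr c (Finset.mem_union_right _ hc)
      have heq : W (F ∪ F₀) = W F₀ := by
        by_contra hne
        exact hmin _ ⟨_, hU, rfl⟩ (lt_of_le_of_ne hle hne)
      have hmem : (r₀ - r₁) • h ∈ W F₀ := by
        refine ⟨r₀ - r₁, (hD _ _).2 fun c hc => ?_, by simp⟩
        have := c.2.2.sub_mem (hr₀ c hc) (hr₁ c (Finset.mem_union_right _ hc))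
        rwa [sub_sub_sub_cancel_right, ← sub_smul] at this
      rw [← heq] at hmem
      obtain ⟨d, hd, hdh⟩ := hmem
      rw [LinearMap.toSpanSingleton_apply] at hdh
      refine ⟨r₁ + d, fun c hc => ?_, by rw [add_smul, hdh, ← add_smul]; congr 1; ring⟩
      have := c.2.2.add_mem (hr₁ c (Finset.mem_union_left _ hc))
        ((hD _ _).1 hd c (Finset.mem_union_left _ hc))
      convert this using 1
      rw [add_smul]; abel
    have hgood : insert (h, r₀ • h, (⊥ : Submodule R H)) G ∈
        {G : Set (H × H × Submodule R H) | ∀ F : Finset (H × H × Submodule R H), ↑F ⊆ G →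
          ∃ r : R, ∀ c ∈ F, r • c.1 - c.2.1 ∈ c.2.2} := by
      intro F hF
      obtain ⟨r, hr, hrh⟩ := hext (F.erase (h, r₀ • h, ⊥)) (by
        intro c hc
        simp only [Finset.coe_erase, Set.mem_sdiff, Set.mem_singleton_iff] at hc
        exact (hF hc.1).resolve_left hc.2)
      refine ⟨r, fun c hc => ?_⟩
      by_cases hce : c = (h, r₀ • h, ⊥)
      · subst hce
        simp [hrh]
      · exact hr c (Finset.mem_erase.2 ⟨hce, hc⟩)
    exact hGmax.le_of_ge hgood (Set.subset_insert _ _) (Set.mem_insert _ _)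
  choose φ hφ using htot
  have hloc : ∀ T : Finset H, ∃ r : R, ∀ h ∈ T, φ h = r • h := by
    intro T
    obtain ⟨r, hr⟩ := hG (T.image fun h => (h, φ h, ⊥)) (by
      intro c hc
      simp only [Finset.coe_image, Set.mem_image] at hc
      obtain ⟨h, -, rfl⟩ := hc
      exact hφ h)
    refine ⟨r, fun h hh => ?_⟩
    have := hr _ (Finset.mem_image_of_mem _ hh)
    simpa [sub_eq_zero, eq_comm] using this
  refine ⟨{ toFun := φ, map_add' := fun a b => ?_, map_smul' := fun t a => ?_ }, hloc, ?_⟩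
  · obtain ⟨r, hr⟩ := hloc {a, b, a + b}
    rw [hr a (by simp), hr b (by simp), hr (a + b) (by simp), smul_add]
  · obtain ⟨r, hr⟩ := hloc {a, t • a}
    rw [hr a (by simp), hr (t • a) (by simp), smul_comm]; rfl
  · intro c hc
    obtain ⟨r, hr⟩ := hG {c, (c.1, φ c.1, ⊥)} (by
      intro x hx
      simp only [Finset.coe_insert, Finset.coe_singleton, Set.mem_insert_iff,
        Set.mem_singleton_iff] at hx
      rcases hx with rfl | rfl
      · exact hG₀G hc
      · exact hφ _)
    have h1 := hr c (by simp)
    have h2 := hr (c.1, φ c.1, ⊥) (by simp)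
    have h3 : r • c.1 = φ c.1 := by simpa [sub_eq_zero] using h2
    rw [h3] at h1
    exact h1

end LocallyScalar

section Duality

variable {R : Type*} [CommRing R] [IsNoetherianRing R] [IsLocalRing R]

open IsLocalRing in
/-- Double annihilator property of finitely generated submodules of an Artinian module in which
every nonzero submodule contains `s ≠ 0`. -/
theorem mem_of_forall_annihilator {U : Type*} [AddCommGroup U] [Module R U] [IsArtinian R U]
    {s : U} (hs : s ≠ 0) (hess : ∀ u : U, u ≠ 0 → ∃ r : R, r • u = s)
    (Y : Submodule R U) (hY : Y.FG) (y : U)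
    (hy : ∀ r : R, (∀ z ∈ Y, r • z = 0) → r • y = 0) : y ∈ Y := by
  have fix : ∀ (a : R) (u : U), a ∈ maximalIdeal R → a • u = u → u = 0 := by
    intro a u ha hau
    obtain ⟨b, hb⟩ := ((mem_nonunits_iff.1 ((mem_maximalIdeal a).1 ha)
      |> isUnit_one_sub_self_of_mem_nonunits a)).exists_left_inv
    have : (1 - a) • u = 0 := by rw [sub_smul, one_smul, hau, sub_self]
    rw [← one_smul R u, ← hb, mul_smul, this, smul_zero]
  have hms : ∀ a ∈ maximalIdeal R, a • s = 0 := by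
    intro a ha
    by_contra hne
    obtain ⟨r, hr⟩ := hess _ hne
    rw [smul_smul] at hr
    exact hs (fix (r * a) s (Ideal.mul_mem_left _ _ ha) hr)
  have hsoc : ∀ u : U, (∀ a ∈ maximalIdeal R, a • u = 0) → ∃ r : R, u = r • s := by
    intro u hu
    by_cases hu0 : u = 0
    · exact ⟨0, by simp [hu0]⟩
    obtain ⟨r, hr⟩ := hess u hu0
    have hru : IsUnit r := by
      by_contra hn
      exact hs (by rw [← hr]; exact hu r ((mem_maximalIdeal r).2 hn))
    obtain ⟨b, hb⟩ := hru.exists_left_inv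
    exact ⟨b, by rw [← hr, smul_smul, hb, one_smul]⟩
  induction Y using WellFoundedLT.induction generalizing y with
  | ind Y ih =>
  by_cases hbot : Y = ⊥
  · subst hbot
    have := hy 1 (by simp)
    simpa using this
  have : IsCoatomic (Set.Iic Y) := by
    have : IsNoetherian R Y := isNoetherian_of_fg_of_noetherian Y hY
    have e : Submodule R Y ≃o Set.Iic Y := Y.mapIic
    exact e.isCoatomic_iff.1 inferInstance
  obtain ⟨Y', hcov⟩ : ∃ Y', Y' ⋖ Y := by
    rcases IsCoatomic.eq_top_or_exists_le_coatom (⊥ : Set.Iic Y) with h | ⟨a, ha, -⟩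
    · exact absurd (congrArg Subtype.val h).symm hbot
    · exact ⟨a, (covBy_iff_coatom_Iic a.2).2 ha⟩
  have hY' : Y'.FG := by
    have : IsNoetherian R Y := isNoetherian_of_fg_of_noetherian Y hY
    exact Submodule.FG.of_le hY hcov.le
  obtain ⟨z, hzY, hzY'⟩ := SetLike.exists_of_lt hcov.lt
  have hspan : ∀ w ∉ Y', w ∈ Y → Y' ⊔ Submodule.span R {w} = Y := by
    intro w hw hwY
    refine (hcov.eq_or_eq le_sup_left (sup_le hcov.le (by simpa using hwY))).resolve_left ?_
    intro h
    exact hw (h ▸ (le_sup_right : _ ≤ Y' ⊔ Submodule.span R {w}) (Submodule.mem_span_singleton_self w))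
  have hmz : ∀ a ∈ maximalIdeal R, a • z ∈ Y' := by
    intro a ha
    by_contra hn
    have hz : z ∈ Y' ⊔ Submodule.span R {a • z} := by
      rw [hspan _ hn (Y.smul_mem a hzY)]; exact hzY
    obtain ⟨y', hy', w, hw, hyw⟩ := Submodule.mem_sup.1 hz
    obtain ⟨t, rfl⟩ := Submodule.mem_span_singleton.1 hw
    have hu : IsUnit (1 - t * a) := isUnit_one_sub_self_of_mem_nonunits _
      ((mem_maximalIdeal _).1 (Ideal.mul_mem_left _ t ha))
    obtain ⟨b, hb⟩ := hu.exists_left_inv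
    apply hzY'
    have : (1 - t * a) • z = y' := by
      rw [sub_smul, one_smul, mul_smul, ← sub_eq_iff_eq_add.2 hyw.symm]
    rw [← one_smul R z, ← hb, mul_smul, this]
    exact Y'.smul_mem b hy'
  have hann : ∀ r : R, (∀ x ∈ Y', r • x = 0) → r • z = 0 → r • y = 0 := by
    intro r hr hrz
    refine hy r fun x hx => ?_
    rw [← hspan z hzY' hzY] at hx
    obtain ⟨y', hy', w, hw, rfl⟩ := Submodule.mem_sup.1 hx
    obtain ⟨t, rfl⟩ := Submodule.mem_span_singleton.1 hw
    rw [smul_add, hr y' hy', smul_comm, hrz, smul_zero, add_zero]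
  obtain ⟨j₀, hj₀, hj₀z⟩ : ∃ j : R, (∀ x ∈ Y', j • x = 0) ∧ j • z = s := by
    have : ¬ ∀ r : R, (∀ x ∈ Y', r • x = 0) → r • z = 0 :=
      fun h => hzY' (ih Y' hcov.lt hY' z h)
    push Not at this
    obtain ⟨r, hr, hrz⟩ := this
    obtain ⟨t, ht⟩ := hess _ hrz
    exact ⟨t * r, fun x hx => by rw [mul_smul, hr x hx, smul_zero], by rw [mul_smul, ht]⟩
  obtain ⟨a, ha⟩ : ∃ a : R, j₀ • y = a • s := by
    refine hsoc _ fun b hb => ?_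
    rw [smul_smul]
    refine hann _ (fun x hx => by rw [mul_smul, hj₀ x hx, smul_zero]) ?_
    rw [mul_smul, hj₀z, hms b hb]
  have hsub : y - a • z ∈ Y' := by
    refine ih Y' hcov.lt hY' _ fun j hj => ?_
    obtain ⟨t, ht⟩ : ∃ t : R, j • z = t • s := by
      refine hsoc _ fun b hb => ?_
      rw [smul_comm]
      exact hj _ (hmz b hb)
    have h1 : (j - t * j₀) • y = 0 := by
      refine hann _ (fun x hx => ?_) ?_
      · rw [sub_smul, mul_smul, hj x hx, hj₀ x hx, smul_zero, sub_zero]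
      · rw [sub_smul, mul_smul, hj₀z, ht, sub_self]
    rw [sub_smul, mul_smul, sub_eq_zero, ha] at h1
    rw [smul_sub, h1, smul_comm j a z, ht, smul_comm, sub_self]
  have := Y.add_mem (hcov.le hsub) (Y.smul_mem a hzY)
  simpa using this

variable {H : Type*} [AddCommGroup H] [Module R H] [IsArtinian R H]

theorem exists_isLocallyScalar_map_le {N A : Submodule R H} {s : H} (hsN : s ∉ N)
    (hN : ∀ L : Submodule R H, N < L → s ∈ L) (hNA : N ≤ A) (hA : A ≠ ⊤) :
    ∃ φ : Module.End R H, IsLocallyScalar φ ∧ (∀ a ∈ A, φ a ∈ N) ∧ ∃ h, φ h ∉ N := by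
  classical
  obtain ⟨e, -, he⟩ := SetLike.exists_of_lt (lt_top_iff_ne_top.2 hA)
  have hs0 : N.mkQ s ≠ 0 := by simpa using hsN
  have hess : ∀ u : H ⧸ N, u ≠ 0 → ∃ r : R, r • u = N.mkQ s := by
    intro u hu
    obtain ⟨x, rfl⟩ := N.mkQ_surjective u
    have hx : x ∉ N := by simpa using hu
    have hlt : N < N ⊔ Submodule.span R {x} :=
      lt_of_le_of_ne le_sup_left fun h => hx
        (h ▸ (le_sup_right : _ ≤ N ⊔ Submodule.span R {x}) (Submodule.mem_span_singleton_self x))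
    obtain ⟨n, hn, w, hw, hnw⟩ := Submodule.mem_sup.1 (hN _ hlt)
    obtain ⟨r, rfl⟩ := Submodule.mem_span_singleton.1 hw
    refine ⟨r, ?_⟩
    have : N.mkQ n = 0 := by simpa using hn
    rw [← hnw, map_add, map_smul, this, zero_add]
  obtain ⟨φ, hφ, hG⟩ := exists_isLocallyScalar_of_finitely_solvable
    (insert (e, s, N) ((fun a => (a, (0 : H), N)) '' (A : Set H))) (by
      intro F hF
      let Y : Submodule R (H ⧸ N) :=
        Submodule.span R ↑((F.filter fun c => c.1 ∈ A).image fun c => N.mkQ c.1)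
      have hYA : Y ≤ A.map N.mkQ := by
        refine Submodule.span_le.2 fun z hz => ?_
        simp only [Finset.coe_image, Set.mem_image, Finset.mem_coe, Finset.mem_filter] at hz
        obtain ⟨c, ⟨-, hc⟩, rfl⟩ := hz
        exact Submodule.mem_map_of_mem hc
      have heY : N.mkQ e ∉ Y := by
        intro h
        obtain ⟨a, ha, hae⟩ := hYA h
        have h1 : e - a ∈ N := by
          rw [← N.ker_mkQ, LinearMap.mem_ker, map_sub, hae, sub_self]
        exact he (by simpa using A.add_mem (hNA h1) ha)
      have : ¬ ∀ r : R, (∀ z ∈ Y, r • z = 0) → r • N.mkQ e = 0 := fun h =>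
        heY (mem_of_forall_annihilator hs0 hess Y ⟨_, rfl⟩ _ h)
      push Not at this
      obtain ⟨r, hr, hre⟩ := this
      obtain ⟨t, ht⟩ := hess _ hre
      refine ⟨t * r, fun c hc => ?_⟩
      rcases hF hc with rfl | ⟨a, ha, rfl⟩
      · rw [← N.ker_mkQ, LinearMap.mem_ker, map_sub, map_smul, mul_smul, ht, sub_self]
      · have h0 := hr (N.mkQ a) (Submodule.subset_span (by
          simp only [Finset.coe_image, Set.mem_image, Finset.mem_coe, Finset.mem_filter]
          exact ⟨_, ⟨hc, ha⟩, rfl⟩))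
        rw [← N.ker_mkQ, LinearMap.mem_ker, map_sub, map_smul, mul_smul, h0, smul_zero, map_zero,
          sub_zero])
  refine ⟨φ, hφ, fun a ha => ?_, e, fun h => hsN ?_⟩
  · simpa using hG _ (Set.mem_insert_of_mem _ ⟨a, ha, rfl⟩)
  · have := N.sub_mem h (hG _ (Set.mem_insert _ _))
    simpa using this

/-- If the locally scalar endomorphisms whose range is not contained in `K` are surjective, an
ascending sequence of submodules above `K` eventually has all its successive quotients killed by
surjective locally scalar endomorphisms. -/
theorem exists_surjective_isLocallyScalar_map_le (K : Submodule R H)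
    (hK : ∀ φ : Module.End R H, IsLocallyScalar φ → (∃ h, φ h ∉ K) → Function.Surjective φ)
    (X : ℕ → Submodule R H) (hX : Monotone X) (hKX : ∀ i, K ≤ X i) (M : Submodule R H) :
    ∃ i₀, ∀ i ≥ i₀, ∃ φ : Module.End R H, IsLocallyScalar φ ∧ Function.Surjective φ ∧
      ∀ x ∈ X (i + 1), x ∈ M → φ x ∈ X i := by
  induction M using WellFoundedLT.induction with
  | ind M ih =>
  by_cases hMK : M ≤ K
  · exact ⟨0, fun i _ => ⟨1, isLocallyScalar_one, Function.surjective_id,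
      fun x _ hx => hKX i (hMK hx)⟩⟩
  obtain ⟨s, hsM, hsK⟩ := SetLike.not_le_iff_exists.1 hMK
  obtain ⟨N, hKN, hNmax⟩ := zorn_le_nonempty₀ {N : Submodule R H | s ∉ N}
    (by
      intro C hC hchain y hy
      refine ⟨sSup C, fun hs => ?_, fun z hz => le_sSup hz⟩
      obtain ⟨L, hL, hsL⟩ := (Submodule.mem_sSup_of_directed ⟨y, hy⟩ hchain.directedOn).1 hs
      exact hC hL hsL) K hsK
  have hsN : s ∉ N := hNmax.prop
  have hN : ∀ L : Submodule R H, N < L → s ∈ L := fun L hL => by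
    by_contra hs
    exact hL.not_ge (hNmax.le_of_ge hs hL.le)
  have hlt : M ⊓ N < M := lt_of_le_of_ne inf_le_left fun h =>
    hsN ((inf_le_right : M ⊓ N ≤ N) (h.symm ▸ hsM))
  obtain ⟨i₁, hi₁⟩ := ih _ hlt
  by_cases htop : ∃ j, M ⊓ X j ⊔ N = ⊤
  · obtain ⟨j, hj⟩ := htop
    refine ⟨max i₁ j, fun i hi => ?_⟩
    obtain ⟨φ, hφ, hsurj, hmap⟩ := hi₁ i (le_of_max_le_left hi)
    refine ⟨φ, hφ, hsurj, fun x hx hxM => ?_⟩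
    obtain ⟨y, hy, n, hn, rfl⟩ := Submodule.mem_sup.1 (hj ▸ Submodule.mem_top : x ∈ M ⊓ X j ⊔ N)
    have hyi : y ∈ X i := hX (le_of_max_le_right hi) hy.2
    have hnM : n ∈ M := by simpa using M.sub_mem hxM hy.1
    have hnX : n ∈ X (i + 1) := by simpa using (X (i + 1)).sub_mem hx (hX i.le_succ hyi)
    rw [map_add]
    exact (X i).add_mem (hφ.apply_mem hyi) (hmap n hnX ⟨hnM, hn⟩)
  · push Not at htop
    refine ⟨i₁, fun i hi => ?_⟩
    obtain ⟨φ, hφ, hsurj, hmap⟩ := hi₁ i hi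
    obtain ⟨ψ, hψ, hψN, h, hh⟩ := exists_isLocallyScalar_map_le hsN hN le_sup_right (htop (i + 1))
    refine ⟨φ * ψ, hφ.mul hψ, hsurj.comp (hK ψ hψ ⟨h, fun hhK => hh (hKN hhK)⟩),
      fun x hx hxM => ?_⟩
    exact hmap _ (hψ.apply_mem hx)
      ⟨hψ.apply_mem hxM, hψN x (Submodule.mem_sup_left ⟨hxM, hx⟩)⟩

end Duality

section Frobenius

variable {R H : Type*} [CommRing R] [AddCommGroup H] [Module R H] {p : ℕ}

theorem iterate_semilinear {ξ : H →+ H} (hsemi : ∀ (r : R) (h : H), ξ (r • h) = r ^ p • ξ h)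
    (e : ℕ) (r : R) (h : H) : ξ^[e] (r • h) = r ^ p ^ e • ξ^[e] h := by
  induction e with
  | zero => simp
  | succ e ih => rw [Function.iterate_succ_apply', Function.iterate_succ_apply', ih, hsemi,
      ← pow_mul, pow_succ]

/-- The kernel of the `e`-th iterate of a Frobenius-semilinear endomorphism. -/
def kerIterate (ξ : H →+ H) (hsemi : ∀ (r : R) (h : H), ξ (r • h) = r ^ p • ξ h) (e : ℕ) :
    Submodule R H where
  carrier := {h | ξ^[e] h = 0}
  zero_mem' := iterate_map_zero ξ e
  add_mem' {a b} ha hb := by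
    simp only [Set.mem_ofPred_eq] at ha hb ⊢
    rw [iterate_map_add, ha, hb, add_zero]
  smul_mem' r h hh := by
    simp only [Set.mem_ofPred_eq] at hh ⊢
    rw [iterate_semilinear hsemi, hh, smul_zero]

variable {ξ : H →+ H} {hsemi : ∀ (r : R) (h : H), ξ (r • h) = r ^ p • ξ h}

theorem mem_kerIterate {e : ℕ} {h : H} : h ∈ kerIterate ξ hsemi e ↔ ξ^[e] h = 0 := Iff.rfl

theorem kerIterate_monotone : Monotone (kerIterate ξ hsemi) := by
  refine monotone_nat_of_le_succ fun e h hh => ?_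
  rw [mem_kerIterate] at hh ⊢
  rw [Function.iterate_succ_apply', hh, map_zero]

theorem IsLocallyScalar.semilinear_iterate {φ : Module.End R H} (hφ : IsLocallyScalar φ)
    (hsemi : ∀ (r : R) (h : H), ξ (r • h) = r ^ p • ξ h) (e : ℕ) (h : H) :
    ξ^[e] (φ h) = (φ ^ p ^ e) (ξ^[e] h) :=
  hφ.semilinear (iterate_semilinear hsemi e) h

/-- If a surjective locally scalar endomorphism kills one quotient of the kernel filtration, the
filtration stops there. -/
theorem kerIterate_eq_top (hp : 2 ≤ p) (htors : ∀ h : H, ∃ e, ξ^[e] h = 0) {a : ℕ}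
    {φ : Module.End R H} (hφ : IsLocallyScalar φ) (hsurj : Function.Surjective φ)
    (hmap : ∀ h ∈ kerIterate ξ hsemi (a + 1), φ h ∈ kerIterate ξ hsemi a) :
    kerIterate ξ hsemi a = ⊤ := by
  have key : ∀ n, ∀ h ∈ kerIterate ξ hsemi (a + n), φ (φ h) ∈ kerIterate ξ hsemi a := by
    intro n
    induction n with
    | zero => exact fun h hh => hφ.apply_mem (hφ.apply_mem hh)
    | succ n ih =>
      intro h hh
      refine hmap _ ?_
      rw [mem_kerIterate, Function.iterate_succ_apply, hφ.semilinear hsemi]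
      have hmem : (φ ^ (p - 2) * φ ^ 2) (ξ h) ∈ kerIterate ξ hsemi a := by
        rw [sq]
        exact (hφ.pow _).apply_mem (ih _ hh)
      rwa [← pow_add, Nat.sub_add_cancel hp, mem_kerIterate] at hmem
  refine Submodule.eq_top_iff'.2 fun x => ?_
  obtain ⟨y, rfl⟩ := hsurj x
  obtain ⟨z, rfl⟩ := hsurj y
  obtain ⟨n, hn⟩ := htors z
  exact key n z (kerIterate_monotone (Nat.le_add_left n a) hn)

/-- In a nonzero Artinian module, the ranges of a family of locally scalar nilpotent endomorphisms
do not span the whole module. -/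
theorem iSup_range_ne_top_of_isNilpotent [IsArtinian R H] [Nontrivial H]
    (P : Set (Module.End R H)) (hP : ∀ φ ∈ P, IsLocallyScalar φ) (hnil : ∀ φ ∈ P, IsNilpotent φ) :
    ⨆ φ ∈ P, LinearMap.range φ ≠ ⊤ := by
  classical
  have hfin : ∀ F : Finset (Module.End R H), ↑F ⊆ P →
      ∃ a : Module.End R H, IsLocallyScalar a ∧ a ≠ 0 ∧ ∀ φ ∈ F, φ * a = 0 := by
    intro F
    induction F using Finset.induction_on with
    | empty => exact fun _ => ⟨1, isLocallyScalar_one, one_ne_zero, by simp⟩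
    | insert c F _ ih =>
      intro hF
      simp only [Finset.coe_insert, Set.insert_subset_iff] at hF
      obtain ⟨a, ha, ha0, hFa⟩ := ih hF.2
      have hc := hP c hF.1
      have hex : ∃ n, c ^ n * a = 0 := by
        obtain ⟨n, hn⟩ := hnil c hF.1
        exact ⟨n, by rw [hn, zero_mul]⟩
      obtain ⟨n, hn⟩ : ∃ n, Nat.find hex = n + 1 := by
        refine Nat.exists_eq_succ_of_ne_zero fun h0 => ha0 ?_
        have := Nat.find_spec hex
        rwa [h0, pow_zero, one_mul] at this
      refine ⟨c ^ n * a, (hc.pow n).mul ha, Nat.find_min hex (by omega), fun φ hφ => ?_⟩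
      rcases Finset.mem_insert.1 hφ with rfl | hφ
      · have := Nat.find_spec hex
        rwa [hn, pow_succ', mul_assoc] at this
      · rw [← mul_assoc, (hc.pow n).commute, mul_assoc, hFa φ hφ, mul_zero]
  let Z : Finset (Module.End R H) → Submodule R H := fun F => ⨅ φ ∈ F, LinearMap.ker φ
  have hZ : ∀ F x, x ∈ Z F ↔ ∀ φ ∈ F, φ x = 0 := by
    intro F x
    simp [Z, Submodule.mem_iInf]
  obtain ⟨_, ⟨F, hF, rfl⟩, hmin⟩ := (wellFounded_lt (α := Submodule R H)).has_min
    (Z '' {F | ↑F ⊆ P}) ⟨Z ∅, ∅, by simp, rfl⟩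
  obtain ⟨a, ha, ha0, hFa⟩ := hfin F hF
  have hPa : ∀ c ∈ P, a * c = 0 := by
    intro c hc
    have hle : Z (insert c F) ≤ Z F := fun x hx =>
      (hZ _ _).2 fun φ hφ => (hZ _ _).1 hx φ (Finset.mem_insert_of_mem hφ)
    have heq : Z (insert c F) = Z F := by
      by_contra hne
      refine hmin _ ⟨_, ?_, rfl⟩ (lt_of_le_of_ne hle hne)
      simpa [Set.insert_subset_iff] using ⟨hc, hF⟩
    rw [(hP c hc).commute]
    ext x
    have hx : a x ∈ Z F := (hZ _ _).2 fun φ hφ => LinearMap.congr_fun (hFa φ hφ) x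
    rw [← heq] at hx
    exact (hZ _ _).1 hx c (Finset.mem_insert_self _ _)
  intro htop
  apply ha0
  rw [← LinearMap.ker_eq_top, eq_top_iff, ← htop]
  refine iSup₂_le fun c hc => ?_
  rintro _ ⟨x, rfl⟩
  exact LinearMap.congr_fun (hPa c hc) x

/-- A torsion Artinian module all of whose proper stable submodules are nilpotent is nilpotent. -/
theorem exists_kerIterate_eq_top [IsNoetherianRing R] [IsLocalRing R] [IsArtinian R H]
    (hp : 2 ≤ p) (htors : ∀ h : H, ∃ e, ξ^[e] h = 0)
    (hprop : ∀ N : Submodule R H, (∀ h ∈ N, ξ h ∈ N) → N ≠ ⊤ → ∃ e, N ≤ kerIterate ξ hsemi e) :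
    ∃ e, kerIterate ξ hsemi e = ⊤ := by
  by_contra! hbad
  have : Nontrivial H := by
    by_contra h
    rw [not_nontrivial_iff_subsingleton] at h
    exact hbad 0 (Subsingleton.elim _ _)
  have hspan : ∀ e, Submodule.span R (Set.range ξ^[e]) = ⊤ := by
    intro e
    by_contra hne
    obtain ⟨f, hf⟩ := hprop _ (fun h hh => by
      induction hh using Submodule.span_induction with
      | mem x hx =>
        obtain ⟨y, rfl⟩ := hx
        refine Submodule.subset_span ⟨ξ y, ?_⟩
        rw [← Function.iterate_succ_apply, Function.iterate_succ_apply']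
      | zero => simp
      | add x y _ _ hx hy => rw [map_add]; exact Submodule.add_mem _ hx hy
      | smul r x _ hx => rw [hsemi]; exact Submodule.smul_mem _ _ hx) hne
    refine hbad (f + e) (Submodule.eq_top_iff'.2 fun x => ?_)
    rw [mem_kerIterate, Function.iterate_add_apply]
    exact hf (Submodule.subset_span ⟨x, rfl⟩)
  let P : Set (Module.End R H) := {φ | IsLocallyScalar φ ∧ ¬ Function.Surjective φ}
  have hnil : ∀ φ ∈ P, IsNilpotent φ := by
    rintro φ ⟨hφ, hns⟩
    obtain ⟨e, he⟩ := hprop (LinearMap.range φ) (by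
      rintro _ ⟨x, rfl⟩
      rw [hφ.semilinear hsemi, show p = p - 1 + 1 by omega, pow_succ']
      exact ⟨_, rfl⟩) (fun h => hns (LinearMap.range_eq_top.1 h))
    refine ⟨p ^ e, ?_⟩
    rw [← LinearMap.ker_eq_top, eq_top_iff, ← hspan e, Submodule.span_le]
    rintro _ ⟨x, rfl⟩
    have : ξ^[e] (φ x) = 0 := he ⟨x, rfl⟩
    rwa [hφ.semilinear_iterate hsemi] at this
  obtain ⟨f, hf⟩ := hprop (⨆ φ ∈ P, LinearMap.range φ) (fun h hh => by
    have hle : ∀ φ ∈ P, LinearMap.range φ ≤ ⨆ φ ∈ P, LinearMap.range φ :=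
      fun φ hφ => le_iSup₂_of_le φ hφ le_rfl
    rw [iSup_subtype'] at hh
    induction hh using Submodule.iSup_induction' with
    | mem φ x hx =>
      obtain ⟨y, rfl⟩ := hx
      refine hle φ.1 φ.2 ?_
      rw [φ.2.1.semilinear hsemi, show p = p - 1 + 1 by omega, pow_succ']
      exact ⟨_, rfl⟩
    | zero => simp
    | add x y _ _ hx hy => rw [map_add]; exact Submodule.add_mem _ hx hy)
    (iSup_range_ne_top_of_isNilpotent P (fun φ hφ => hφ.1) hnil)
  obtain ⟨i, hi⟩ := exists_surjective_isLocallyScalar_map_le (kerIterate ξ hsemi f)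
    (fun φ hφ ⟨h, hh⟩ => by
      by_contra hns
      exact hh (hf (le_iSup₂_of_le (f := fun (φ : Module.End R H) (_ : φ ∈ P) =>
        LinearMap.range φ) φ ⟨hφ, hns⟩ le_rfl ⟨h, rfl⟩)))
    (fun i => kerIterate ξ hsemi (f + i))
    (fun i j hij => kerIterate_monotone (Nat.add_le_add_left hij f))
    (fun i => kerIterate_monotone (Nat.le_add_right f i)) ⊤
  obtain ⟨φ, hφ, hsurj, hmap⟩ := hi i le_rfl
  exact hbad (f + i) (kerIterate_eq_top hp htors hφ hsurj
    fun h hh => hmap h hh Submodule.mem_top)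

theorem exists_le_kerIterate [IsNoetherianRing R] [IsLocalRing R] [IsArtinian R H]
    (hp : 2 ≤ p) (M : Submodule R H) (hM : ∀ h ∈ M, ξ h ∈ M)
    (htors : ∀ h ∈ M, ∃ e, ξ^[e] h = 0) : ∃ e, M ≤ kerIterate ξ hsemi e := by
  induction M using WellFoundedLT.induction with
  | ind M ih =>
  let η : M →+ M := (ξ.comp M.subtype.toAddMonoidHom).codRestrict M fun x => hM x x.2
  have hη : ∀ (r : R) (h : M), η (r • h) = r ^ p • η h := fun r h => Subtype.ext (hsemi r h)
  have hiter : ∀ (e : ℕ) (h : M), ((η^[e] h : M) : H) = ξ^[e] h := by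
    intro e
    induction e with
    | zero => simp
    | succ e ihe => intro h; rw [Function.iterate_succ_apply, Function.iterate_succ_apply, ihe]; rfl
  obtain ⟨e, he⟩ := exists_kerIterate_eq_top (hsemi := hη) hp
    (fun h => (htors h h.2).imp fun e he => Subtype.ext (by simpa [hiter] using he)) (by
      intro N hN hNtop
      have hlt : N.map M.subtype < M := by
        refine lt_of_le_of_ne (Submodule.map_subtype_le M N) fun h => hNtop ?_
        exact Submodule.map_injective_of_injective M.injective_subtype (by simpa using h)
      obtain ⟨e, he⟩ := ih _ hlt
        (by rintro _ ⟨x, hx, rfl⟩; exact ⟨η x, hN x hx, rfl⟩)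
        (fun h hh => htors h (hlt.le hh))
      exact ⟨e, fun x hx => Subtype.ext (by
        rw [hiter]; exact he ⟨x, hx, rfl⟩)⟩)
  refine ⟨e, fun x hx => ?_⟩
  have : (⟨x, hx⟩ : M) ∈ kerIterate η hη e := he ▸ Submodule.mem_top
  rw [mem_kerIterate, ← hiter e ⟨x, hx⟩, mem_kerIterate.1 this]
  rfl

end Frobenius

end HartshorneSpeiserLyubeznik


/-- Hartshorne–Speiser–Lyubeznik.  Let `(R,𝔪)` be a local commutative
Noetherian ring of prime characteristic `p`, and let `H` be an `R`-module which is
Artinian and which carries a Frobenius-semilinear endomorphism `ξ`.  Then there exists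
`e ∈ ℕ` such that `ξ^e h = 0` for every `h ∈ Γ_x(H)`. -/
theorem stmt1 (R : Type*) [CommRing R] [IsNoetherianRing R] [IsLocalRing R]
    (p : ℕ) (hp : p.Prime) [CharP R p]
    (H : Type*) [AddCommGroup H] [Module R H] [IsArtinian R H]
    (ξ : H → H)
    (hadd : ∀ a b : H, ξ (a + b) = ξ a + ξ b)
    (hsemi : ∀ (r : R) (h : H), ξ (r • h) = r ^ p • ξ h) :
    ∃ e : ℕ, ∀ h : H, (∃ j : ℕ, 0 < j ∧ ξ^[j] h = 0) → ξ^[e] h = 0 := by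
  obtain ⟨ξ, rfl⟩ : ∃ η : H →+ H, ⇑η = ξ := ⟨AddMonoidHom.mk' ξ hadd, rfl⟩
  obtain ⟨e, he⟩ := HartshorneSpeiserLyubeznik.exists_le_kerIterate (hsemi := hsemi) hp.two_le
    (⨆ j, HartshorneSpeiserLyubeznik.kerIterate ξ hsemi j)
    (fun h hh => by
      rw [Submodule.mem_iSup_of_directed _
        HartshorneSpeiserLyubeznik.kerIterate_monotone.directed_le] at hh ⊢
      obtain ⟨j, hj⟩ := hh
      refine ⟨j, ?_⟩
      rw [HartshorneSpeiserLyubeznik.mem_kerIterate] at hj ⊢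
      rw [← Function.iterate_succ_apply, Function.iterate_succ_apply', hj, map_zero])
    (fun h hh => (Submodule.mem_iSup_of_directed _
      HartshorneSpeiserLyubeznik.kerIterate_monotone.directed_le).1 hh)
  exact ⟨e, fun h ⟨j, _, hj⟩ => he (Submodule.mem_iSup_of_mem j hj)⟩
end

section
/- Let R be a (not necessarily local) commutative Noetherian ring of prime characteristic p, and let H be an R-module which is Artinian and which carries a Frobenius-semilinear endomorphism ξ. Then there exists e ∈ ℕ such that ξ^e(h) = 0 for every h ∈ Γ_x(H). -/
theorem exists_notMem_smul_mem_of_antitone {B : Type*} [CommRing B] [IsNoetherianRing B]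
    {J P : Ideal B} (hP : P ∈ J.minimalPrimes) (V : Type*) [AddCommGroup V] [Module B V]
    [hV : Module.Finite B V] (hJ : ∀ a ∈ J, ∀ v : V, a • v = 0) (N : ℕ → Submodule B V)
    (hN : Antitone N) :
    ∃ e₀, ∀ e ≥ e₀, ∃ r ∉ P, ∀ v ∈ N e, r • v ∈ N (e + 1) := by
  have hPp : P.IsPrime := hP.1.1
  induction hV using IsNoetherianRing.induction_on_isQuotientEquivQuotientPrime B with
  | subsingleton V =>
    refine ⟨0, fun e _ => ⟨1, P.one_notMem, fun v _ => ?_⟩⟩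
    rw [Subsingleton.elim ((1 : B) • v) 0]
    exact zero_mem _
  | quotient V q f =>
    have hact : ∀ a ∈ q.1, ∀ v : V, a • v = 0 := fun a ha v => f.injective <| by
      obtain ⟨b, hb⟩ := Ideal.Quotient.mk_surjective (f v)
      rw [map_smul, map_zero, ← hb, Algebra.smul_def, Ideal.Quotient.algebraMap_eq, ← map_mul,
        Ideal.Quotient.eq_zero_iff_mem]
      exact q.1.mul_mem_right _ ha
    by_cases hqP : q.1 ≤ P
    · have hJq : J ≤ q.1 := fun a ha => by
        have := congrArg f (hJ a ha (f.symm 1))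
        rwa [map_smul, map_zero, f.apply_symm_apply, Algebra.smul_def, mul_one,
          Ideal.Quotient.algebraMap_eq, Ideal.Quotient.eq_zero_iff_mem] at this
      obtain rfl : q.1 = P := le_antisymm hqP (hP.2 ⟨q.2, hJq⟩ hqP)
      by_cases hbot : ∃ e₀, N e₀ = ⊥
      · obtain ⟨e₀, he₀⟩ := hbot
        refine ⟨e₀, fun e he => ⟨1, q.1.one_notMem, fun v hv => ?_⟩⟩
        have : v ∈ N e₀ := hN he hv
        rw [he₀, Submodule.mem_bot] at this
        simp [this]
      · push Not at hbot
        refine ⟨0, fun e _ => ?_⟩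
        obtain ⟨w, hw, hw0⟩ := (Submodule.ne_bot_iff _).1 (hbot (e + 1))
        obtain ⟨r, hr⟩ := Ideal.Quotient.mk_surjective (f w)
        refine ⟨r, fun hrq => hw0 (f.injective ?_), fun v _ => ?_⟩
        · rw [← hr, map_zero, Ideal.Quotient.eq_zero_iff_mem]; exact hrq
        · obtain ⟨b, hb⟩ := Ideal.Quotient.mk_surjective (f v)
          have : r • v = b • w := f.injective <| by
            rw [map_smul, map_smul, ← hb, ← hr, Algebra.smul_def, Algebra.smul_def,
              Ideal.Quotient.algebraMap_eq, mul_comm]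
          rw [this]
          exact (N (e + 1)).smul_mem _ hw
    · obtain ⟨r, hr, hrP⟩ := SetLike.not_le_iff_exists.1 hqP
      exact ⟨0, fun e _ => ⟨r, hrP, fun v _ => by rw [hact r hr]; exact zero_mem _⟩⟩
  | exact V₁ V₂ V₃ f g hf hg hfg ih₁ ih₃ =>
    obtain ⟨e₁, h₁⟩ := ih₁ (fun a ha v => hf <| by rw [map_smul, hJ a ha, map_zero])
      (fun e => (N e).comap f) (fun _ _ h => Submodule.comap_mono (hN h))
    obtain ⟨e₃, h₃⟩ := ih₃
      (fun a ha v => by obtain ⟨w, rfl⟩ := hg v; rw [← map_smul, hJ a ha, map_zero])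
      (fun e => (N e).map g) (fun _ _ h => Submodule.map_mono (hN h))
    refine ⟨max e₁ e₃, fun e he => ?_⟩
    obtain ⟨r, hr, hr'⟩ := h₁ e (le_of_max_le_left he)
    obtain ⟨s, hs, hs'⟩ := h₃ e (le_of_max_le_right he)
    refine ⟨r * s, fun h => (hPp.mem_or_mem h).elim hr hs, fun v hv => ?_⟩
    obtain ⟨y, hy, hyv⟩ := hs' (g v) (Submodule.mem_map_of_mem hv)
    obtain ⟨w, hw⟩ := (hfg (s • v - y)).1 (by rw [map_sub, map_smul, hyv, sub_self])
    have hwN : f w ∈ N e := hw ▸ (N e).sub_mem ((N e).smul_mem _ hv) (hN e.le_succ hy)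
    have := hr' w hwN
    rw [Submodule.mem_comap, map_smul, hw] at this
    have := (N (e + 1)).add_mem this ((N (e + 1)).smul_mem r hy)
    rwa [← smul_add, sub_add_cancel, ← mul_smul] at this

/-- Version of `exists_notMem_smul_mem_of_antitone` relative to a submodule. -/
theorem exists_notMem_smul_mem_of_antitone_of_smul_mem {B : Type*} [CommRing B]
    [IsNoetherianRing B] {J P : Ideal B} (hP : P ∈ J.minimalPrimes) {M : Type*} [AddCommGroup M]
    [Module B M] [IsNoetherian B M] (N : ℕ → Submodule B M) (hN : Antitone N) (e₁ : ℕ)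
    (hJ : ∀ e ≥ e₁, J • N e₁ ≤ N e) :
    ∃ e₀ ≥ e₁, ∀ e ≥ e₀, ∃ r ∉ P, ∀ v ∈ N e, r • v ∈ N (e + 1) := by
  let W : Submodule B (N e₁) := J • ⊤
  obtain ⟨e₀, h⟩ := exists_notMem_smul_mem_of_antitone hP (N e₁ ⧸ W)
    (fun a ha v => by
      obtain ⟨v, rfl⟩ := W.mkQ_surjective v
      rw [← map_smul]
      exact (Submodule.Quotient.mk_eq_zero W).2 (Submodule.smul_mem_smul ha trivial))
    (fun e => ((N e).comap (N e₁).subtype).map W.mkQ)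
    (fun _ _ h => Submodule.map_mono (Submodule.comap_mono (hN h)))
  refine ⟨max e₀ e₁, le_max_right _ _, fun e he => ?_⟩
  obtain ⟨r, hr, hrN⟩ := h e (le_of_max_le_left he)
  refine ⟨r, hr, fun v hv => ?_⟩
  have he₁ : e₁ ≤ e := le_of_max_le_right he
  obtain ⟨w, hw, hwv⟩ := hrN _ (Submodule.mem_map_of_mem (f := W.mkQ)
    (show (⟨v, hN he₁ hv⟩ : N e₁) ∈ (N e).comap (N e₁).subtype from hv))
  rw [← map_smul] at hwv
  have h₁ := Submodule.mem_map_of_mem (f := (N e₁).subtype) ((Submodule.Quotient.eq W).1 hwv)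
  have h₂ : W.map (N e₁).subtype ≤ N (e + 1) := by
    rw [Submodule.map_smul'', Submodule.map_top, Submodule.range_subtype]
    exact hJ _ (by omega)
  have := (N (e + 1)).sub_mem hw (h₂ h₁)
  simpa using this

/-- The kernel of the `e`-th iterate of a `p`-semilinear map. -/
def kerIterate {B H : Type*} [CommRing B] [AddCommGroup H] [Module B H] (p : ℕ) (ξ : H →+ H)
    (hξ : ∀ (b : B) (h : H), ξ (b • h) = b ^ p • ξ h) (e : ℕ) : Submodule B H where
  carrier := {h | ξ^[e] h = 0}
  zero_mem' := iterate_map_zero ξ e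
  add_mem' := fun {a b} ha hb => by
    change ξ^[e] a = 0 at ha
    change ξ^[e] b = 0 at hb
    change ξ^[e] (a + b) = 0
    rw [iterate_map_add, ha, hb, add_zero]
  smul_mem' := fun b h hh => by
    have : ∀ (n : ℕ) (b : B) (h : H), ξ^[n] h = 0 → ξ^[n] (b • h) = 0 := by
      intro n
      induction n with
      | zero => intro b h hh; simp only [Function.iterate_zero, id_eq] at hh ⊢; rw [hh, smul_zero]
      | succ n ih => intro b h hh; rw [Function.iterate_succ_apply] at hh ⊢; rw [hξ]; exact ih _ _ hh
    exact this e b h hh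

theorem exists_forall_iterate_eq_zero_of_separating {B H E : Type*} [CommRing B]
    [IsNoetherianRing B] [AddCommGroup H] [Module B H] [AddCommGroup E] [Module B E]
    [IsNoetherian B (H →ₗ[B] E)]
    (hsep : ∀ (K : Submodule B H), ∀ h ∉ K, ∃ f : H →ₗ[B] E, (∀ k ∈ K, f k = 0) ∧ f h ≠ 0)
    {p : ℕ} (hp : 2 ≤ p) (ξ : H →+ H) (hξ : ∀ (b : B) (h : H), ξ (b • h) = b ^ p • ξ h) :
    ∃ e, ∀ h j, ξ^[j] h = 0 → ξ^[e] h = 0 := by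
  set K := kerIterate p ξ hξ with hKdef
  have hmem : ∀ e h, h ∈ K e ↔ ξ^[e] h = 0 := fun _ _ => Iff.rfl
  have hmem_succ : ∀ e h, h ∈ K (e + 1) ↔ ξ h ∈ K e := fun e h => by
    rw [hmem, hmem, Function.iterate_succ_apply]
  have hK : Monotone K := monotone_nat_of_le_succ fun e h hh => by
    rw [hmem] at hh ⊢
    rw [Function.iterate_succ_apply', hh, map_zero]
  suffices ∃ e₀, ∀ e ≥ e₀, K (e + 1) ≤ K e by
    obtain ⟨e₀, h₀⟩ := this
    have hstab : ∀ n, K (e₀ + n) ≤ K e₀ := fun n => by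
      induction n with
      | zero => exact le_rfl
      | succ n ih => exact (h₀ (e₀ + n) (by omega)).trans ih
    exact ⟨e₀, fun h j hj => hstab j (hK (Nat.le_add_left j e₀) hj)⟩
  let a : ℕ → Ideal B := fun e => (K e).colon (K (e + 1) : Set H)
  have ha_mem : ∀ e b, b ∈ a e ↔ ∀ h ∈ K (e + 1), b • h ∈ K e := fun e b => by
    simp only [a, Submodule.mem_colon, SetLike.mem_coe]
  have ha : Monotone a := monotone_nat_of_le_succ fun e b hb => by
    rw [ha_mem] at hb ⊢
    intro h hh
    rw [hmem_succ, hξ, ← Nat.sub_add_cancel (by omega : 1 ≤ p), pow_succ, mul_smul]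
    exact (K e).smul_mem _ (hb _ ((hmem_succ _ _).1 hh))
  obtain ⟨e₁, he₁⟩ := monotone_stabilizes_iff_noetherian.2 inferInstance (⟨a, ha⟩ : ℕ →o Ideal B)
  replace he₁ : ∀ e ≥ e₁, a e₁ = a e := he₁
  set I := a e₁ with hI
  have htop : I = ⊤ → ∃ e₀, ∀ e ≥ e₀, K (e + 1) ≤ K e := fun h => ⟨e₁, fun e he k hk => by
    have : (1 : B) ∈ a e := by rw [← he₁ e he, h]; trivial
    simpa using (ha_mem _ _).1 this k hk⟩
  refine htop ?_
  by_contra hItop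
  have hsq : ∀ x ∈ I, ∀ n, ∀ h ∈ K (e₁ + n), x ^ 2 • h ∈ K e₁ := by
    intro x hx n
    induction n with
    | zero => exact fun h hh => (K _).smul_mem _ hh
    | succ n ih =>
      intro h hh
      rw [← add_assoc, hmem_succ] at hh
      rw [sq, mul_smul]
      refine (ha_mem e₁ x).1 hx _ ((hmem_succ _ _).2 ?_)
      rw [hξ, ← Nat.sub_add_cancel hp, pow_add, mul_smul]
      exact (K e₁).smul_mem _ (ih _ hh)
  let J : Ideal B := Ideal.span ((fun x => x ^ 2) '' (I : Set B))
  have hJI : J ≤ I := Ideal.span_le.2 <| by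
    rintro _ ⟨x, hx, rfl⟩
    exact I.pow_mem_of_mem hx 2 two_pos
  have hJK : ∀ e ≥ e₁, ∀ b ∈ J, ∀ h ∈ K e, b • h ∈ K e₁ := fun e he b hb h hh => by
    suffices J ≤ (K e₁).colon (K e : Set H) from Submodule.mem_colon.1 (this hb) h hh
    refine Ideal.span_le.2 ?_
    rintro _ ⟨x, hx, rfl⟩
    refine Submodule.mem_colon.2 fun h hh => hsq x hx (e - e₁) h ?_
    rwa [Nat.add_sub_cancel' he]
  obtain ⟨P, hP⟩ := Ideal.nonempty_minimalPrimes hItop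
  have hPp : P.IsPrime := hP.1.1
  have hPJ : P ∈ J.minimalPrimes := ⟨⟨hPp, hJI.trans hP.1.2⟩, fun Q hQ hQP =>
    hP.2 ⟨hQ.1, fun x hx => hQ.1.mem_of_pow_mem 2 (hQ.2 (Ideal.subset_span ⟨x, hx, rfl⟩))⟩ hQP⟩
  let N : ℕ → Submodule B (H →ₗ[B] E) := fun e =>
    { carrier := {f | ∀ k ∈ K e, f k = 0}
      zero_mem' := fun _ _ => rfl
      add_mem' := fun {f g} hf hg k hk => by rw [LinearMap.add_apply, hf k hk, hg k hk, add_zero]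
      smul_mem' := fun b f hf k hk => by rw [LinearMap.smul_apply, hf k hk, smul_zero] }
  have hN : Antitone N := fun _ _ h f hf k hk => hf k (hK h hk)
  obtain ⟨e₀, he₀, h₀⟩ := exists_notMem_smul_mem_of_antitone_of_smul_mem hPJ N hN e₁
    (fun e he => Submodule.smul_le.2 fun b hb f hf k hk => by
      rw [LinearMap.smul_apply, ← map_smul]
      exact hf _ (hJK e he b hb k hk))
  obtain ⟨r, hr, hrN⟩ := h₀ e₀ le_rfl
  refine hr (hP.1.2 ?_)
  rw [he₁ e₀ he₀, ha_mem]
  intro h hh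
  by_contra hnot
  obtain ⟨f, hf, hfh⟩ := hsep _ _ hnot
  refine hfh ?_
  rw [map_smul]
  exact hrN f hf h hh

open CategoryTheory
universe u

theorem Submodule.exists_maximal_disjoint {B Q : Type*} [Ring B] [AddCommGroup Q] [Module B Q]
    {a b : Submodule B Q} (h : Disjoint a b) :
    ∃ m, a ≤ m ∧ Maximal (fun m => Disjoint m b) m := by
  obtain ⟨m, hm, hmax⟩ := zorn_le_nonempty₀ {m : Submodule B Q | Disjoint m b}
    (fun c hc hchain y hy => ⟨sSup c, hchain.directedOn.disjoint_sSup_left.2 fun x hx => hc hx,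
      fun z hz => le_sSup hz⟩) a h
  exact ⟨m, hm, hmax⟩

theorem exists_baer_embedding (B : Type u) [CommRing B] (M : Type u) [AddCommGroup M] [Module B M] :
    ∃ (Q : Type u) (_ : AddCommGroup Q) (_ : Module B Q) (ι : M →ₗ[B] Q),
      Module.Baer B Q ∧ Function.Injective ι := by
  let Q : ModuleCat.{u} B := Injective.under (ModuleCat.of B M)
  let i : ModuleCat.of B M ⟶ Q := Injective.ι (ModuleCat.of B M)
  have : CategoryTheory.Injective (ModuleCat.of B Q) :=
    inferInstanceAs (CategoryTheory.Injective (Injective.under (ModuleCat.of B M)))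
  exact ⟨Q, inferInstance, inferInstance, i.hom,
    Module.Baer.of_injective (Module.injective_module_of_injective_object B Q),
    (ModuleCat.mono_iff_injective i).1 (Injective.ι_mono _)⟩

theorem Module.Baer.exists_essential_submodule {B Q : Type*} [CommRing B] [AddCommGroup Q]
    [Module B Q] (hQ : Module.Baer B Q) (k : Submodule B Q) :
    ∃ E : Submodule B Q, k ≤ E ∧ Module.Baer B E ∧ ∀ F ≤ E, Disjoint F k → F = ⊥ := by
  obtain ⟨C, -, hC⟩ := Submodule.exists_maximal_disjoint (disjoint_bot_left (a := k))
  obtain ⟨E, hkE, hE⟩ := Submodule.exists_maximal_disjoint hC.1.symm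
  have hEC : ∀ x ∈ E, x ∈ C → x = 0 := fun x h₁ h₂ => Submodule.disjoint_def.1 hE.1 x h₁ h₂
  obtain ⟨g, hg⟩ := hQ.extension_property (C.mkQ ∘ₗ E.subtype)
    ((injective_iff_map_eq_zero _).2 fun x hx => Subtype.ext <|
      hEC x x.2 ((Submodule.Quotient.mk_eq_zero C).1 hx)) E.subtype
  replace hg : ∀ x ∈ E, g (C.mkQ x) = x := fun x hx => LinearMap.congr_fun hg ⟨x, hx⟩
  have hrange : LinearMap.range g ≤ E := by
    refine hE.2 (Submodule.disjoint_def.2 ?_)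
      (fun x hx => ⟨C.mkQ x, hg x hx⟩ : E ≤ LinearMap.range g)
    rintro _ ⟨q, rfl⟩ hq
    obtain ⟨q, rfl⟩ := C.mkQ_surjective q
    have hle : (C.comap g).comap C.mkQ ≤ C := by
      refine hC.2 (Submodule.disjoint_def.2 fun x hx hxk => ?_) fun x hx => ?_
      · rw [Submodule.mem_comap, Submodule.mem_comap, hg x (hkE hxk)] at hx
        exact hEC x (hkE hxk) hx
      · rw [Submodule.mem_comap, Submodule.mem_comap, Submodule.mkQ_apply,
          (Submodule.Quotient.mk_eq_zero C).2 hx, map_zero]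
        exact zero_mem _
    rw [Submodule.mkQ_apply, (Submodule.Quotient.mk_eq_zero C).2 (hle hq), map_zero]
  refine ⟨E, hkE, fun I γ => ?_, fun F hF hFk => ?_⟩
  · obtain ⟨γ', hγ'⟩ := hQ I (E.subtype ∘ₗ γ)
    refine ⟨LinearMap.codRestrict E (g ∘ₗ C.mkQ ∘ₗ γ') fun x => hrange ⟨_, rfl⟩, fun x hx =>
      Subtype.ext ?_⟩
    change g (C.mkQ (γ' x)) = _
    rw [hγ' x hx]
    exact hg _ (γ ⟨x, hx⟩).2
  · have : C ⊔ F ≤ C := by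
      refine hC.2 (Submodule.disjoint_def.2 fun x hx hxk => ?_) le_sup_left
      obtain ⟨c, hc, f, hf, rfl⟩ := Submodule.mem_sup.1 hx
      have hc0 : c = 0 := hEC c (by simpa using E.sub_mem (hkE hxk) (hF hf)) hc
      rw [hc0, zero_add] at hxk ⊢
      exact Submodule.disjoint_def.1 hFk f hf hxk
    exact (Submodule.eq_bot_iff F).2 fun x hx => hEC x (hF hx) (this (le_sup_right (a := C) hx))

theorem isSemisimpleModule_of_isTorsionBySet {B M : Type*} [CommRing B] {I : Ideal B}
    [IsSemisimpleRing (B ⧸ I)] [AddCommGroup M] [Module B M]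
    (h : Module.IsTorsionBySet B M (I : Set B)) : IsSemisimpleModule B M := by
  let _ := h.module
  exact h.isSemisimpleModule_iff.1 inferInstance

theorem exists_baer_hull_quotient {B : Type u} [CommRing B] (I : Ideal B)
    [IsSemisimpleRing (B ⧸ I)] :
    ∃ (E : Type u) (_ : AddCommGroup E) (_ : Module B E) (ι : (B ⧸ I) →ₗ[B] E),
      Module.Baer B E ∧ Function.Injective ι ∧
        ∀ x : E, (∀ a ∈ I, a • x = 0) → x ∈ LinearMap.range ι := by
  obtain ⟨Q, _, _, ι, hQ, hι⟩ := exists_baer_embedding B (B ⧸ I)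
  obtain ⟨E, hkE, hE, hess⟩ := hQ.exists_essential_submodule (LinearMap.range ι)
  refine ⟨E, inferInstance, inferInstance, ι.codRestrict E fun x => hkE ⟨x, rfl⟩, hE,
    fun x y h => hι (congrArg Subtype.val h), ?_⟩
  let T := Submodule.torsionBySet B E (I : Set B)
  have hT : IsSemisimpleModule B T :=
    isSemisimpleModule_of_isTorsionBySet (I := I) fun x a =>
      Subtype.ext ((Submodule.mem_torsionBySet_iff _ _).1 x.2 a)
  let k' : Submodule B T := (LinearMap.range ι).comap (E.subtype ∘ₗ T.subtype)
  obtain ⟨D, hD⟩ := exists_isCompl k'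
  have hDbot : D.map (E.subtype ∘ₗ T.subtype) = ⊥ := by
    refine hess _ ?_ (Submodule.disjoint_def.2 ?_)
    · rintro _ ⟨x, -, rfl⟩
      exact x.1.2
    · rintro _ ⟨x, hx, rfl⟩ hxk
      have : x = 0 := Submodule.disjoint_def.1 hD.disjoint x hxk hx
      rw [this, map_zero]
  have hinj : Function.Injective (E.subtype ∘ₗ T.subtype) :=
    Subtype.val_injective.comp Subtype.val_injective
  have hk' : k' = ⊤ := by
    have : D = ⊥ := (Submodule.map_injective_of_injective hinj) (hDbot.trans (by simp))
    simpa [this] using hD.codisjoint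
  intro x hx
  obtain ⟨y, hy⟩ : (⟨x, (Submodule.mem_torsionBySet_iff _ _).2 fun a => hx a a.2⟩ : T) ∈ k' :=
    hk' ▸ trivial
  exact ⟨y, Subtype.ext hy⟩

theorem exists_smul_ne_zero_of_pow_smul_eq_zero {B M : Type*} [CommRing B] {I : Ideal B}
    [AddCommGroup M] [Module B M] {x : M} (hx : x ≠ 0) {n : ℕ} (hn : ∀ a ∈ I ^ n, a • x = 0) :
    ∃ a : B, a • x ≠ 0 ∧ ∀ b ∈ I, b • a • x = 0 := by
  induction n with
  | zero => exact absurd (by simpa using hn 1 (by simp)) hx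
  | succ n ih =>
    by_cases h : ∀ a ∈ I ^ n, a • x = 0
    · exact ih h
    · push Not at h
      obtain ⟨a, ha, hax⟩ := h
      refine ⟨a, hax, fun b hb => ?_⟩
      rw [← mul_smul, mul_comm]
      exact hn _ (by rw [pow_succ]; exact Ideal.mul_mem_mul ha hb)

theorem exists_linearMap_apply_ne_zero {B : Type*} [CommRing B] {I : Ideal B}
    [IsSemisimpleRing (B ⧸ I)] {E : Type*} [AddCommGroup E] [Module B E] (hE : Module.Baer B E)
    {ι : (B ⧸ I) →ₗ[B] E} (hι : Function.Injective ι) {M : Type*} [AddCommGroup M] [Module B M]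
    {x : M} (hx : x ≠ 0) {n : ℕ} (hn : ∀ a ∈ I ^ n, a • x = 0) :
    ∃ f : M →ₗ[B] E, f x ≠ 0 := by
  obtain ⟨a, hax, ha⟩ := exists_smul_ne_zero_of_pow_smul_eq_zero hx hn
  let f : (B ⧸ I) →ₗ[B] M := Submodule.liftQ I (LinearMap.toSpanSingleton B M (a • x)) ha
  have hf : f (I.mkQ 1) = a • x := one_smul B _
  have : IsSemisimpleModule B (B ⧸ I) :=
    isSemisimpleModule_of_isTorsionBySet 
      ((Module.isTorsionBySet_quotient_iff I _).2 fun x r h => I.mul_mem_right x h)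
  obtain ⟨σ, hσ⟩ := IsSemisimpleModule.lifting_property (LinearMap.ker f).mkQ
    (Submodule.mkQ_surjective _) LinearMap.id
  have hσ' : Function.Injective σ :=
    Function.LeftInverse.injective (g := (LinearMap.ker f).mkQ) (LinearMap.congr_fun hσ)
  obtain ⟨g, hg⟩ := hE.extension_property ((LinearMap.ker f).liftQ f le_rfl)
    (LinearMap.ker_eq_bot.1 (Submodule.ker_liftQ_eq_bot _ _ _ le_rfl)) (ι ∘ₗ σ)
  refine ⟨g, fun hgx => hax ?_⟩
  have h₁ : ι (σ ((LinearMap.ker f).mkQ (I.mkQ 1))) = 0 := by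
    rw [← LinearMap.comp_apply ι σ, ← hg, LinearMap.comp_apply, Submodule.mkQ_apply,
      Submodule.liftQ_apply, hf, map_smul, hgx, smul_zero]
  rw [← hf]
  exact (Submodule.Quotient.mk_eq_zero _).1
    ((map_eq_zero_iff σ hσ').1 ((map_eq_zero_iff ι hι).1 h₁))

theorem exists_linearMap_separating {B : Type*} [CommRing B] {I : Ideal B}
    [IsSemisimpleRing (B ⧸ I)] {E : Type*} [AddCommGroup E] [Module B E] (hE : Module.Baer B E)
    {ι : (B ⧸ I) →ₗ[B] E} (hι : Function.Injective ι) {M : Type*} [AddCommGroup M] [Module B M]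
    (hM : ∀ x : M, ∃ n, ∀ a ∈ I ^ n, a • x = 0) (K : Submodule B M) {x : M} (hx : x ∉ K) :
    ∃ f : M →ₗ[B] E, (∀ k ∈ K, f k = 0) ∧ f x ≠ 0 := by
  obtain ⟨n, hn⟩ := hM x
  obtain ⟨f, hf⟩ := exists_linearMap_apply_ne_zero hE hι (x := K.mkQ x)
    (fun h => hx ((Submodule.Quotient.mk_eq_zero K).1 h))
    (n := n) (fun a ha => by rw [← map_smul, hn a ha, map_zero])
  refine ⟨f ∘ₗ K.mkQ, fun k hk => ?_, hf⟩
  rw [LinearMap.comp_apply, Submodule.mkQ_apply, (Submodule.Quotient.mk_eq_zero K).2 hk, map_zero]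

theorem isPrecomplete_pi_fin {B : Type*} [CommRing B] (I : Ideal B) [IsPrecomplete I B] (s : ℕ) :
    IsPrecomplete I (Fin s → B) := by
  have hle : ∀ n (x : Fin s → B), x ∈ (I ^ n • ⊤ : Submodule B (Fin s → B)) ↔ ∀ i, x i ∈ I ^ n := by
    intro n x
    refine ⟨fun hx i => ?_, fun hx => ?_⟩
    · have := Submodule.mem_map_of_mem (f := LinearMap.proj (R := B) (φ := fun _ : Fin s => B) i) hx
      rw [Submodule.map_smul''] at this
      simpa using Submodule.smul_mono le_rfl le_top this
    · rw [pi_eq_sum_univ x]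
      exact Submodule.sum_mem _ fun i _ => Submodule.smul_mem_smul (hx i) trivial
  refine ⟨fun f hf => ?_⟩
  have : ∀ i, ∃ L : B, ∀ n, f n i ≡ L [SMOD (I ^ n • ⊤ : Submodule B B)] := fun i =>
    IsPrecomplete.prec' (fun n => f n i) fun {m n} hmn => by
      have := hf hmn
      rw [SModEq.sub_mem, hle] at this
      simpa [SModEq.sub_mem] using this i
  choose L hL using this
  refine ⟨L, fun n => ?_⟩
  rw [SModEq.sub_mem, hle]
  intro i
  simpa [SModEq.sub_mem] using hL i n

theorem Module.Finite.of_finite_quotient_smul_top {B M : Type*} [CommRing B] (I : Ideal B)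
    [IsPrecomplete I B] [AddCommGroup M] [Module B M] [IsHausdorff I M]
    [Module.Finite B (M ⧸ (I • ⊤ : Submodule B M))] : Module.Finite B M := by
  obtain ⟨s, F, hF⟩ := Module.Finite.exists_fin' B (M ⧸ (I • ⊤ : Submodule B M))
  obtain ⟨G, hG⟩ := Module.projective_lifting_property (Submodule.mkQ _) F
    (Submodule.mkQ_surjective (I • ⊤ : Submodule B M))
  have := isPrecomplete_pi_fin I s
  exact Module.Finite.of_surjective G
    (surjective_of_mkQ_comp_surjective (I := I) (by rw [hG]; exact hF))

theorem Module.Baer.mem_smul_top_of_forall_eq_zero {B E H : Type*} [CommRing B]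
    [AddCommGroup E] [Module B E] [AddCommGroup H] [Module B H] (hE : Module.Baer B E)
    {X : Ideal B} (hX : X.FG) {g : H →ₗ[B] E} (hg : ∀ h, (∀ a ∈ X, a • h = 0) → g h = 0) :
    g ∈ (X • ⊤ : Submodule B (H →ₗ[B] E)) := by
  obtain ⟨n, x, rfl⟩ := Submodule.fg_iff_exists_fin_generating_family.1 hX
  let φ : H →ₗ[B] (Fin n → H) := LinearMap.pi fun j => LinearMap.lsmul B H (x j)
  have hφ : LinearMap.ker φ ≤ LinearMap.ker g := fun h hh => hg h fun a ha => by
    suffices Submodule.span B (Set.range x) ≤ LinearMap.ker (LinearMap.toSpanSingleton B H h) from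
      this ha
    rw [Submodule.span_le]
    rintro _ ⟨j, rfl⟩
    exact congrFun hh j
  obtain ⟨u, hu⟩ := hE.extension_property ((LinearMap.ker φ).liftQ φ le_rfl)
    (LinearMap.ker_eq_bot.1 (Submodule.ker_liftQ_eq_bot _ _ _ le_rfl))
    ((LinearMap.ker φ).liftQ g hφ)
  have hgu : g = ∑ j, x j • (u ∘ₗ LinearMap.single B (fun _ => H) j) := by
    ext h
    have := LinearMap.congr_fun hu ((LinearMap.ker φ).mkQ h)
    simp only [LinearMap.comp_apply, Submodule.mkQ_apply, Submodule.liftQ_apply] at this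
    rw [← this, LinearMap.sum_apply, ← Finset.univ_sum_single (φ h), map_sum]
    refine Finset.sum_congr rfl fun j _ => ?_
    rw [LinearMap.smul_apply, LinearMap.comp_apply, ← map_smul, ← map_smul]
    rfl
  rw [hgu]
  exact Submodule.sum_mem _ fun j _ =>
    Submodule.smul_mem_smul (Submodule.subset_span ⟨j, rfl⟩) trivial

theorem finite_linearMap_of_baer {B E H : Type*} [CommRing B] [IsNoetherianRing B]
    [AddCommGroup E] [Module B E] [AddCommGroup H] [Module B H] (hE : Module.Baer B E)
    {X I : Ideal B} [IsPrecomplete X B] [IsSemisimpleRing (B ⧸ I)]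
    (ι : (B ⧸ I) →ₗ[B] E) (hι : ∀ x : E, (∀ a ∈ I, a • x = 0) → x ∈ LinearMap.range ι)
    [IsArtinian B H] (hX : ∀ h : H, ∃ n, ∀ a ∈ X ^ n, a • h = 0)
    (hXI : ∀ h : H, (∀ a ∈ X, a • h = 0) → ∀ a ∈ I, a • h = 0) :
    Module.Finite B (H →ₗ[B] E) := by
  have : IsHausdorff X (H →ₗ[B] E) := ⟨fun f hf => LinearMap.ext fun h => by
    obtain ⟨n, hn⟩ := hX h
    have := hf n
    rw [SModEq.zero] at this
    refine Submodule.smul_induction_on this (fun a ha f _ => ?_) fun f g hf hg => ?_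
    · rw [LinearMap.smul_apply, ← map_smul, hn a ha, map_zero, LinearMap.zero_apply]
    · rw [LinearMap.add_apply, hf, hg, LinearMap.zero_apply, add_zero]⟩
  let T := Submodule.torsionBySet B H (X : Set B)
  have hTX : ∀ h, h ∈ T ↔ ∀ a ∈ X, a • h = 0 := fun h => by
    rw [Submodule.mem_torsionBySet_iff]; exact Subtype.forall
  have hTI : ∀ t : T, ∀ a ∈ I, a • (t : H) = 0 := fun t => hXI t ((hTX _).1 t.2)
  have : IsSemisimpleModule B T :=
    isSemisimpleModule_of_isTorsionBySet (I := I) fun t a => Subtype.ext (hTI t a a.2)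
  have : Module.Finite B T := 
    ((IsSemisimpleModule.finite_tfae (R := B) (M := T)).out 0 2).2 (inferInstance : IsArtinian B T)
  obtain ⟨s, F, hF⟩ := Module.Finite.exists_fin' B T
  let v : Fin s → T := fun i => F (Pi.single i 1)
  let ρ : (H →ₗ[B] E) →ₗ[B] (Fin s → LinearMap.range ι) := LinearMap.pi fun i =>
    LinearMap.codRestrict (LinearMap.range ι) (LinearMap.applyₗ (v i : H)) fun f =>
      hι _ fun a ha => by rw [LinearMap.applyₗ_apply_apply, ← map_smul, hTI _ a ha, map_zero]
  have hker : LinearMap.ker ρ ≤ X • ⊤ := fun g hg =>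
    hE.mem_smul_top_of_forall_eq_zero (IsNoetherian.noetherian X) fun h hh => by
      have hgv : g ∘ₗ T.subtype ∘ₗ F = 0 := LinearMap.pi_ext' fun i => LinearMap.ext_ring
        (congrArg Subtype.val (congrFun hg i))
      obtain ⟨c, hc⟩ := hF ⟨h, (hTX h).2 hh⟩
      have := LinearMap.congr_fun hgv c
      rwa [LinearMap.comp_apply, LinearMap.comp_apply, hc] at this
  have : IsNoetherian B ((H →ₗ[B] E) ⧸ LinearMap.ker ρ) :=
    isNoetherian_of_injective ((LinearMap.ker ρ).liftQ ρ le_rfl)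
      (LinearMap.ker_eq_bot.1 (Submodule.ker_liftQ_eq_bot _ _ _ le_rfl))
  have : Module.Finite B ((H →ₗ[B] E) ⧸ (X • ⊤ : Submodule B (H →ₗ[B] E))) :=
    Module.Finite.of_surjective (Submodule.factor hker) (Submodule.factor_surjective hker)
  exact Module.Finite.of_finite_quotient_smul_top X

theorem MvPowerSeries.exists_module_of_forall_pow_smul_eq_zero {R H : Type*} [CommRing R]
    [AddCommGroup H] [Module R H] {n : ℕ} (x : Fin n → R)
    (hH : ∀ h : H, ∃ m, ∀ a ∈ Ideal.span (Set.range x) ^ m, a • h = 0) :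
    ∃ _ : Module (MvPowerSeries (Fin n) R) H,
      (∀ (r : R) (h : H), (C r : MvPowerSeries (Fin n) R) • h = r • h) ∧
      (∀ (i : Fin n) (h : H), (X i : MvPowerSeries (Fin n) R) • h = x i • h) ∧
      ∀ (b : MvPowerSeries (Fin n) R) (h h' : H), ∃ r : R,
        r - constantCoeff b ∈ Ideal.span (Set.range x) ∧ b • h = r • h ∧ b • h' = r • h' := by
  let I := Ideal.span (Set.range x)
  let ev : MvPolynomial (Fin n) R →ₐ[R] R := MvPolynomial.aeval x
  have hev : ∀ m, ∀ f ∈ MvPolynomial.idealOfVars (Fin n) R ^ m, ev f ∈ I ^ m := fun m f hf => by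
    have : (MvPolynomial.idealOfVars (Fin n) R).map ev.toRingHom = I := by
      simp [MvPolynomial.idealOfVars, Ideal.map_span, ← Set.range_comp, Function.comp_def, ev, I]
    rw [← this, ← Ideal.map_pow]
    exact Ideal.mem_map_of_mem _ hf
  have hext : ∀ m f g, f - g ∈ MvPolynomial.idealOfVars (Fin n) R ^ m →
      ∀ h : H, (∀ a ∈ I ^ m, a • h = 0) → ev f • h = ev g • h := fun m f g hfg h hh => by
    rw [← sub_eq_zero, ← sub_smul, ← map_sub]
    exact hh _ (hev m _ hfg)
  choose N hN using hH
  let act : MvPowerSeries (Fin n) R → H → H := fun b h => ev (truncTotal (N h) b) • h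
  have hact : ∀ b h m, (∀ a ∈ I ^ m, a • h = 0) → act b h = ev (truncTotal m b) • h := by
    intro b h m hm
    rcases le_total (N h) m with hle | hle
    · exact hext _ _ _ (truncTotal_sub_truncTotal_mem_pow_idealOfVars le_rfl hle b) h (hN h)
    · exact hext _ _ _ (truncTotal_sub_truncTotal_mem_pow_idealOfVars hle le_rfl b) h hm
  have hle : ∀ {m m'} {h : H}, m ≤ m' → (∀ a ∈ I ^ m, a • h = 0) → ∀ a ∈ I ^ m', a • h = 0 :=
    fun hm h a ha => h a (Ideal.pow_le_pow_right hm ha)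
  have hsmul : ∀ {m} {h : H} (r : R), (∀ a ∈ I ^ m, a • h = 0) → ∀ a ∈ I ^ m, a • r • h = 0 :=
    fun r h a ha => by rw [smul_comm, h a ha, smul_zero]
  have hact_coe : ∀ (f : MvPolynomial (Fin n) R) (h : H),
      act (f : MvPowerSeries (Fin n) R) h = ev f • h := fun f h => by
    refine hext (N h) _ _ ((MvPolynomial.mem_pow_idealOfVars_iff' ..).2 fun d hd => ?_) h (hN h)
    rw [MvPolynomial.coeff_sub, coeff_truncTotal _ hd, MvPolynomial.coeff_coe, sub_self]
  let M : Module (MvPowerSeries (Fin n) R) H :=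
    { smul := act
      one_smul := fun h => by
        change act 1 h = h
        have := hact_coe 1 h
        rwa [MvPolynomial.coe_one, map_one, one_smul] at this
      mul_smul := fun b c h => by
        change act (b * c) h = act b (act c h)
        rw [hact c h _ (hN h), hact b _ _ (hsmul _ (hN h)), hact _ h _ (hN h), ← mul_smul, ← map_mul]
        exact hext _ _ _ (truncTotal_mul_sub_mul_truncTotal_mem_pow_idealOfVars b c) h (hN h)
      smul_zero := fun b => smul_zero _
      smul_add := fun b h h' => by
        change act b (h + h') = act b h + act b h'
        have h₁ := hle (le_max_left (N h) (N h')) (hN h)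
        have h₂ := hle (le_max_right (N h) (N h')) (hN h')
        rw [hact b _ _ h₁, hact b _ _ h₂, hact b (h + h') _ fun a ha => by
          rw [smul_add, h₁ a ha, h₂ a ha, add_zero], smul_add]
      add_smul := fun b c h => by
        change act (b + c) h = act b h + act c h
        simp only [act, map_add, add_smul]
      zero_smul := fun h => by
        change act 0 h = 0
        simp only [act, map_zero, zero_smul] }
  refine ⟨M, fun r h => ?_, fun i h => ?_, fun b h h' => ?_⟩
  · have := hact_coe (MvPolynomial.C r) h
    rwa [MvPolynomial.coe_C, MvPolynomial.algHom_C] at this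
  · have := hact_coe (MvPolynomial.X i) h
    rwa [MvPolynomial.coe_X, MvPolynomial.aeval_X] at this
  · let m := max (N h) (N h') + 1
    refine ⟨ev (truncTotal m b), ?_, hact b h m (hle (by grind) (hN h)),
      hact b h' m (hle (by grind) (hN h'))⟩
    have := hev 1 (truncTotal m b - MvPolynomial.C (constantCoeff b))
      ((MvPolynomial.mem_pow_idealOfVars_iff' ..).2 fun d hd => ?_)
    · rwa [pow_one, map_sub, MvPolynomial.algHom_C] at this
    · obtain rfl : d = 0 := by simpa [Finsupp.degree_eq_zero_iff] using hd
      rw [MvPolynomial.coeff_sub, coeff_truncTotal _ (by simp [m]), MvPolynomial.coeff_zero_C]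
      simp

theorem exists_forall_iterate_eq_zero_of_isSemisimpleRing {R H : Type*} [CommRing R]
    [IsNoetherianRing R] [AddCommGroup H] [Module R H] [IsArtinian R H] (I : Ideal R)
    [IsSemisimpleRing (R ⧸ I)] (hH : ∀ h : H, ∃ m, ∀ a ∈ I ^ m, a • h = 0)
    {p : ℕ} (hp : 2 ≤ p) (ξ : H →+ H) (hξ : ∀ (r : R) (h : H), ξ (r • h) = r ^ p • ξ h) :
    ∃ e, ∀ h j, ξ^[j] h = 0 → ξ^[e] h = 0 := by
  obtain ⟨n, x, rfl⟩ := Submodule.fg_iff_exists_fin_generating_family.1 (IsNoetherian.noetherian I)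
  obtain ⟨_, hC, hX, hact⟩ := MvPowerSeries.exists_module_of_forall_pow_smul_eq_zero x hH
  let B := MvPowerSeries (Fin n) R
  let q : B →+* R ⧸ Ideal.span (Set.range x) :=
    (Ideal.Quotient.mk _).comp MvPowerSeries.constantCoeff
  have hq : Function.Surjective q := Ideal.Quotient.mk_surjective.comp fun r =>
    ⟨MvPowerSeries.C r, MvPowerSeries.constantCoeff_C r⟩
  let L : Ideal B := RingHom.ker q
  have : IsSemisimpleRing (B ⧸ L) :=
    (RingHom.quotientKerEquivOfSurjective hq).symm.isSemisimpleRing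
  have hL : ∀ b ∈ L, ∀ h : H, ∃ r ∈ Ideal.span (Set.range x), b • h = r • h := fun b hb h => by
    obtain ⟨r, hr, hbr, -⟩ := hact b h h
    refine ⟨r, ?_, hbr⟩
    have hc : MvPowerSeries.constantCoeff b ∈ Ideal.span (Set.range x) :=
      Ideal.Quotient.eq_zero_iff_mem.1 hb
    simpa using add_mem hr hc
  have hLtors : ∀ h : H, ∃ m, ∀ b ∈ L ^ m, b • h = 0 := fun h => by
    suffices ∀ m, ∀ h : H, (∀ a ∈ Ideal.span (Set.range x) ^ m, a • h = 0) →
        ∀ b ∈ L ^ m, b • h = 0 from (hH h).imp fun m hm => this m h hm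
    intro m
    induction m with
    | zero => intro h hh b _; rw [show h = 0 by simpa using hh 1 (by simp), smul_zero]
    | succ m ih =>
      intro h hh b hb
      rw [pow_succ] at hb
      refine Submodule.mul_induction_on hb (fun b hb c hc => ?_) fun b c hb hc => ?_
      · obtain ⟨r, hr, hcr⟩ := hL c hc h
        rw [mul_smul, hcr]
        refine ih _ (fun a ha => ?_) b hb
        rw [← mul_smul]
        exact hh _ (by rw [pow_succ]; exact Ideal.mul_mem_mul ha hr)
      · rw [add_smul, hb, hc, add_zero]
  let X : Ideal B := Ideal.span (Set.range (MvPowerSeries.X : Fin n → MvPowerSeries (Fin n) R))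
  have hXL : X ≤ L := Ideal.span_le.2 <| by
    rintro _ ⟨i, rfl⟩
    change Ideal.Quotient.mk _ (MvPowerSeries.constantCoeff (MvPowerSeries.X i)) = 0
    rw [MvPowerSeries.constantCoeff_X, map_zero]
  have : IsPrecomplete X B := (inferInstance : IsAdicComplete X B).toIsPrecomplete
  have : IsScalarTower R B H := IsScalarTower.of_algebraMap_smul hC
  have : IsArtinian B H := isArtinian_of_tower R inferInstance
  obtain ⟨E, _, _, ι, hE, hι, hιL⟩ := exists_baer_hull_quotient L
  have : Module.Finite B (H →ₗ[B] E) := by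
    refine finite_linearMap_of_baer (X := X) hE ι hιL (fun h => ?_) fun h hh b hb => ?_
    · exact (hLtors h).imp fun m hm a ha => hm a (Ideal.pow_right_mono hXL m ha)
    · obtain ⟨r, hr, hbr⟩ := hL b hb h
      rw [hbr]
      suffices Ideal.span (Set.range x) ≤ LinearMap.ker (LinearMap.toSpanSingleton R H h) from
        this hr
      rw [Ideal.span_le]
      rintro _ ⟨i, rfl⟩
      change x i • h = 0
      rw [← hX]
      exact hh _ (Ideal.subset_span ⟨i, rfl⟩)
  refine exists_forall_iterate_eq_zero_of_separating (B := B) (E := E)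
    (fun K h hh => exists_linearMap_separating hE hι hLtors K hh) hp ξ fun b h => ?_
  obtain ⟨r, -, hbr, hbr'⟩ := hact b h (ξ h)
  rw [hbr, hξ]
  have : ∀ k : ℕ, b ^ k • ξ h = r ^ k • ξ h := fun k => by
    induction k with
    | zero => simp
    | succ k ih => rw [pow_succ', mul_smul, ih, ← hC, smul_smul, mul_comm, mul_smul, hbr', hC,
        ← mul_smul, pow_succ]
  exact (this p).symm

theorem Submodule.exists_finite_isSemisimpleModule_of_isArtinian (R H : Type*) [CommRing R]
    [AddCommGroup H] [Module R H] [IsArtinian R H] :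
    ∃ T : Submodule R H, Module.Finite R T ∧ IsSemisimpleModule R T ∧
      ∀ N : Submodule R H, N ≠ ⊥ → N ⊓ T ≠ ⊥ := by
  let s : Set (Submodule R H) := {m | IsAtom m}
  have hT : IsSemisimpleModule R (⨆ m ∈ s, m : Submodule R H) :=
    isSemisimpleModule_biSup_of_isSemisimpleModule_submodule (p := id) fun m hm =>
      have := isSimpleModule_iff_isAtom.2 hm
      inferInstanceAs (IsSemisimpleModule R m)
  refine ⟨⨆ m ∈ s, m, ((IsSemisimpleModule.finite_tfae (R := R)).out 0 2).2
    (inferInstance : IsArtinian R (⨆ m ∈ s, m : Submodule R H)), hT, fun N hN h => ?_⟩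
  obtain ⟨S, hS, hSN⟩ := (eq_bot_or_exists_atom_le N).resolve_left hN
  exact hS.1 (le_bot_iff.1 (h ▸ le_inf hSN (le_iSup₂_of_le S hS le_rfl)))

theorem isSemisimpleRing_quotient_annihilator (R M : Type*) [CommRing R]
    [AddCommGroup M] [Module R M] [Module.Finite R M] [IsSemisimpleModule R M] :
    IsSemisimpleRing (R ⧸ Module.annihilator R M) := by
  obtain ⟨n, F, hF⟩ := Module.Finite.exists_fin' R M
  let φ : R →ₗ[R] (Fin n → M) :=
    LinearMap.pi fun i => LinearMap.toSpanSingleton R M (F (Pi.single i 1))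
  have hφ : LinearMap.ker φ = Module.annihilator R M := by
    ext r
    rw [Module.mem_annihilator, LinearMap.mem_ker]
    refine ⟨fun h m => ?_, fun h => funext fun i => h _⟩
    obtain ⟨c, rfl⟩ := hF m
    have : r • F = 0 := LinearMap.pi_ext' fun i => LinearMap.ext_ring (congrFun h i)
    exact LinearMap.congr_fun this c
  have : IsSemisimpleModule R (R ⧸ LinearMap.ker φ) :=
    IsSemisimpleModule.of_injective ((LinearMap.ker φ).liftQ φ le_rfl)
      (LinearMap.ker_eq_bot.1 (Submodule.ker_liftQ_eq_bot _ _ _ le_rfl))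
  rw [hφ] at this
  let l : (R ⧸ Module.annihilator R M) →ₛₗ[Ideal.Quotient.mk (Module.annihilator R M)]
      (R ⧸ Module.annihilator R M) :=
    { toFun := id
      map_add' := fun _ _ => rfl
      map_smul' := fun _ _ => rfl }
  exact (l.isSemisimpleModule_iff_of_bijective Function.bijective_id).1 this

theorem exists_isSemisimpleRing_quotient_of_isArtinian (R H : Type*) [CommRing R]
    [IsNoetherianRing R] [AddCommGroup H] [Module R H] [IsArtinian R H] :
    ∃ I : Ideal R, IsSemisimpleRing (R ⧸ I) ∧ ∀ h : H, ∃ m, ∀ a ∈ I ^ m, a • h = 0 := by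
  obtain ⟨T, _, _, hT⟩ := Submodule.exists_finite_isSemisimpleModule_of_isArtinian R H
  let I := Module.annihilator R T
  refine ⟨I, isSemisimpleRing_quotient_annihilator R T, fun h => ?_⟩
  let D : ℕ →o (Submodule R H)ᵒᵈ :=
    ⟨fun m => OrderDual.toDual (I ^ m • Submodule.span R {h}), fun m m' hm =>
      Submodule.smul_mono_left (Ideal.pow_le_pow_right hm)⟩
  obtain ⟨m, hm⟩ := IsArtinian.monotone_stabilizes D
  set N : Submodule R H := I ^ m • Submodule.span R {h} with hN
  have hIN : I • N = N := by
    rw [hN, ← mul_smul, ← pow_succ']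
    exact (hm (m + 1) m.le_succ).symm
  obtain ⟨r, hr, hrN⟩ := Submodule.exists_sub_one_mem_and_smul_eq_zero_of_fg_of_le_smul I N
    (Submodule.FG.smul (IsNoetherian.noetherian _) (Submodule.fg_span_singleton h)) hIN.ge
  have hbot : N = ⊥ := by
    by_contra hne
    obtain ⟨y, hy, hy0⟩ := (Submodule.ne_bot_iff _).1 (hT N hne)
    have h₁ : (r - 1) • (⟨y, hy.2⟩ : T) = 0 := Module.mem_annihilator.1 hr _
    have h₂ : (r - 1) • y = 0 := congrArg Subtype.val h₁
    rw [sub_smul, hrN y hy.1, one_smul, zero_sub, neg_eq_zero] at h₂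
    exact hy0 h₂
  exact ⟨m, fun a ha => (Submodule.eq_bot_iff _).1 hbot _
    (Submodule.smul_mem_smul ha (Submodule.mem_span_singleton_self h))⟩

/-- Let `R` be a (not necessarily local) commutative Noetherian ring of
prime characteristic `p`, and let `H` be an `R`-module which is Artinian and which carries
a Frobenius-semilinear endomorphism `ξ`.  Then there exists `e ∈ ℕ` such that
`ξ^e h = 0` for every `h ∈ Γ_x(H)`. -/
theorem stmt2 (R : Type*) [CommRing R] [IsNoetherianRing R]
    (p : ℕ) (hp : p.Prime) [CharP R p]
    (H : Type*) [AddCommGroup H] [Module R H] [IsArtinian R H]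
    (ξ : H → H)
    (hadd : ∀ a b : H, ξ (a + b) = ξ a + ξ b)
    (hsemi : ∀ (r : R) (h : H), ξ (r • h) = r ^ p • ξ h) :
    ∃ e : ℕ, ∀ h : H, (∃ j : ℕ, 0 < j ∧ ξ^[j] h = 0) → ξ^[e] h = 0 := by
  obtain ⟨I, _, hI⟩ := exists_isSemisimpleRing_quotient_of_isArtinian R H
  obtain ⟨e, he⟩ := exists_forall_iterate_eq_zero_of_isSemisimpleRing I hI hp.two_le
    (AddMonoidHom.mk' ξ hadd) hsemi
  exact ⟨e, fun h ⟨j, _, hj⟩ => he h j hj⟩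
end

section
/- Let R be a commutative Noetherian ring of prime characteristic p, let G be an x-torsion-free R-module with Frobenius-semilinear endomorphism ξ which is Artinian as an R-module, and let 𝔠 be an ideal of R. For each i ∈ ℕ set N_i := {g ∈ G : c·ξ^i(g) = 0 for all c ∈ 𝔠}. Then there exists a (uniquely determined) v₀ ∈ ℕ such that N_i ⊋ N_{i+1} for all i < v₀ and N_n = N_{v₀} for all n ≥ v₀. In particular, for g ∈ G: if c·ξ^{n₁}(g) = 0 for all c ∈ 𝔠 for one single integer n₁ ≥ v₀, then c·ξ^n(g) = 0 for all c ∈ 𝔠 and all n ∈ ℕ. -/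
/-- The least stable index of a descending sequence of sets in which one equality of consecutive
terms forces the next. -/
theorem exists_stability_index {α : Type*} (N : ℕ → Set α) (hanti : Antitone N)
    (hstep : ∀ i, N i = N (i + 1) → N (i + 1) = N (i + 2)) (hex : ∃ i, N i = N (i + 1)) :
    ∃ v₀ : ℕ, (∀ i, i < v₀ → N (i + 1) ⊂ N i) ∧ ∀ n, v₀ ≤ n → N n = N v₀ := by
  classical
  refine ⟨Nat.find hex, fun i hi => ?_, fun n hn => ?_⟩
  · exact (hanti i.le_succ).ssubset_of_ne fun h => Nat.find_min hex hi h.symm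
  · have hsucc : ∀ m, Nat.find hex ≤ m → N m = N (m + 1) := fun m hm =>
      Nat.le_induction (Nat.find_spec hex) (fun k _ ih => hstep k ih) m hm
    induction n, hn using Nat.le_induction with
    | base => rfl
    | succ k hk ih => rw [← hsucc k hk, ih]

theorem stability_index_unique {α : Type*} (N : ℕ → Set α) {v w : ℕ}
    (hv : (∀ i, i < v → N (i + 1) ⊂ N i) ∧ ∀ n, v ≤ n → N n = N v)
    (hw : (∀ i, i < w → N (i + 1) ⊂ N i) ∧ ∀ n, w ≤ n → N n = N w) : v = w := by
  have key : ∀ a b : ℕ, (∀ n, a ≤ n → N n = N a) → (∀ i, i < b → N (i + 1) ⊂ N i) →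
      b ≤ a := fun a b ha hb => by
    by_contra! h
    exact (hb a h).ne (ha (a + 1) a.le_succ)
  exact le_antisymm (key w v hw.2 hv.1) (key v w hv.2 hw.1)

/-- The submodule of elements whose image under the `i`-th iterate of a Frobenius-semilinear map
is annihilated by `𝔠`. -/
def semilinearAnnihilated {R G : Type*} [CommRing R] [AddCommGroup G] [Module R G] (p : ℕ)
    (ξ : G →+ G) (hsemi : ∀ (r : R) (g : G), ξ (r • g) = r ^ p • ξ g) (𝔠 : Ideal R) (i : ℕ) :
    Submodule R G where
  carrier := {g | ∀ c ∈ 𝔠, c • ξ^[i] g = 0}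
  zero_mem' c _ := by rw [iterate_map_zero, smul_zero]
  add_mem' {a b} ha hb c hc := by
    rw [iterate_map_add, smul_add, ha c hc, hb c hc, add_zero]
  smul_mem' r g hg c hc := by
    have hiter : ξ^[i] (r • g) = r ^ p ^ i • ξ^[i] g := by
      clear hg
      induction i generalizing r g with
      | zero => simp
      | succ k ih =>
        rw [Function.iterate_succ_apply, hsemi, ih, ← pow_mul, ← pow_succ',
          Function.iterate_succ_apply]
    rw [hiter, smul_comm, hg c hc, smul_zero]

theorem antitone_semilinearAnnihilated {R G : Type*} [CommRing R] [AddCommGroup G] [Module R G]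
    {p : ℕ} (hp : p ≠ 0) (ξ : G →+ G) (hsemi : ∀ (r : R) (g : G), ξ (r • g) = r ^ p • ξ g)
    (hinj : ∀ g, ξ g = 0 → g = 0) (𝔠 : Ideal R) :
    Antitone (semilinearAnnihilated p ξ hsemi 𝔠) := by
  refine antitone_nat_of_succ_le fun i g hg c hc => hinj _ ?_
  rw [hsemi, ← Function.iterate_succ_apply' ξ i g]
  exact hg _ (Ideal.pow_mem_of_mem 𝔠 hc p (Nat.pos_of_ne_zero hp))


/-- Let `R` be a commutative Noetherian ring of prime characteristic `p`,
let `G` be an `x`-torsion-free `R`-module with Frobenius-semilinear endomorphism `ξ` which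
is Artinian as an `R`-module, and let `𝔠` be an ideal of `R`; set
`N_i := {g ∈ G : c • ξ^i g = 0 for all c ∈ 𝔠}`.  Then there exists a (uniquely
determined) `v₀ ∈ ℕ` such that `N_i ⊋ N_{i+1}` for all `i < v₀` and `N_n = N_{v₀}` for
all `n ≥ v₀`.  In particular, for `g ∈ G`: if `c • ξ^{n₁} g = 0` for all `c ∈ 𝔠` for one
single integer `n₁ ≥ v₀`, then `c • ξ^n g = 0` for all `c ∈ 𝔠` and all `n ∈ ℕ`. -/
theorem stmt7 (R : Type*) [CommRing R] [IsNoetherianRing R]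
    (p : ℕ) (hp : p.Prime) [CharP R p]
    (G : Type*) [AddCommGroup G] [Module R G] [IsArtinian R G]
    (ξ : G → G)
    (hadd : ∀ a b : G, ξ (a + b) = ξ a + ξ b)
    (hsemi : ∀ (r : R) (g : G), ξ (r • g) = r ^ p • ξ g)
    (htf : ∀ g : G, (∃ j : ℕ, 0 < j ∧ ξ^[j] g = 0) → g = 0)
    (𝔠 : Ideal R)
    (N : ℕ → Set G) (hN : ∀ i : ℕ, N i = {g : G | ∀ c ∈ 𝔠, c • ξ^[i] g = 0}) :
    ∃ v₀ : ℕ,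
      ((∀ i : ℕ, i < v₀ → N (i + 1) ⊂ N i) ∧ (∀ n : ℕ, v₀ ≤ n → N n = N v₀)) ∧
      (∀ v : ℕ, ((∀ i : ℕ, i < v → N (i + 1) ⊂ N i) ∧ (∀ n : ℕ, v ≤ n → N n = N v)) →
        v = v₀) ∧
      (∀ (g : G) (n₁ : ℕ), v₀ ≤ n₁ → (∀ c ∈ 𝔠, c • ξ^[n₁] g = 0) →
        ∀ n : ℕ, ∀ c ∈ 𝔠, c • ξ^[n] g = 0) := by
  let f : G →+ G := AddMonoidHom.mk' ξ hadd
  let M := semilinearAnnihilated p f hsemi 𝔠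
  have hNM : ∀ i, N i = M i := hN
  have hM : Antitone M := antitone_semilinearAnnihilated hp.ne_zero f hsemi
    (fun g hg => htf g ⟨1, Nat.one_pos, hg⟩) 𝔠
  have hanti : Antitone N := fun i j hij => by
    rw [hNM, hNM]
    exact hM hij
  have hpre : ∀ i, N (i + 1) = ξ ⁻¹' N i := fun i => by
    rw [hN, hN]
    rfl
  have hex : ∃ i, N i = N (i + 1) := by
    obtain ⟨i, hi⟩ := IsArtinian.monotone_stabilizes (⟨M, hM⟩ : ℕ →o (Submodule R G)ᵒᵈ)
    refine ⟨i, ?_⟩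
    rw [hNM, hNM]
    exact congrArg (fun S : Submodule R G => (S : Set G)) (hi (i + 1) i.le_succ)
  obtain ⟨v₀, hv₀⟩ := exists_stability_index N hanti
    (fun i h => by rw [hpre (i + 1), ← h, ← hpre]; exact h) hex
  refine ⟨v₀, hv₀, fun v hv => stability_index_unique N hv hv₀, fun g n₁ hn₁ hg n => ?_⟩
  have hmem : g ∈ N v₀ := by
    rw [← hv₀.2 n₁ hn₁, hN]
    exact hg
  have hn : g ∈ N n := by
    rcases le_total n v₀ with h | h
    · exact hanti h hmem
    · rwa [hv₀.2 n h]
  rwa [hN] at hn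
end

section
/- Let R be a commutative Noetherian ring of prime characteristic p, let H be an R-module with Frobenius-semilinear endomorphism ξ, and let m₀ ∈ ℕ be such that ξ^{m₀}(h) = 0 for all h ∈ Γ_x(H). Let 𝔠 be an ideal of R and t₀ ∈ ℕ. Then the set A := {h ∈ H : c^{p^{m₀}}·ξ^n(h) = 0 for all c ∈ 𝔠 and all n ≥ m₀ + t₀} is an R-submodule of H, stable under ξ, containing Γ_x(H); moreover A = {h ∈ H : c·ξ^n(h) ∈ Γ_x(H) for all c ∈ 𝔠 and all n ≥ t₀} = {h ∈ H : a·ξ^n(h) ∈ Γ_x(H) for all a ∈ √𝔠 and all n ∈ ℕ} = {h ∈ H : a^{p^{m₀}}·ξ^n(h) = 0 for all a ∈ √𝔠 and all n ≥ m₀}. -/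
theorem iterate_map_zero_of_additive {H : Type*} [AddCommGroup H] {ξ : H → H}
    (hadd : ∀ a b : H, ξ (a + b) = ξ a + ξ b) (n : ℕ) : ξ^[n] 0 = 0 :=
  iterate_map_zero (AddMonoidHom.mk' ξ hadd) n

theorem iterate_map_add_of_additive {H : Type*} [AddCommGroup H] {ξ : H → H}
    (hadd : ∀ a b : H, ξ (a + b) = ξ a + ξ b) (n : ℕ) (a b : H) :
    ξ^[n] (a + b) = ξ^[n] a + ξ^[n] b :=
  iterate_map_add (AddMonoidHom.mk' ξ hadd) n a b

theorem iterate_smul_of_pow_semilinear {R H : Type*} [CommRing R] [AddCommGroup H] [Module R H]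
    {p : ℕ} {ξ : H → H} (hsemi : ∀ (r : R) (h : H), ξ (r • h) = r ^ p • ξ h)
    (n : ℕ) (r : R) (h : H) : ξ^[n] (r • h) = r ^ p ^ n • ξ^[n] h := by
  induction n with
  | zero => simp
  | succ k ih => rw [Function.iterate_succ_apply', ih, hsemi, Function.iterate_succ_apply',
      ← pow_mul, ← pow_succ]

theorem smul_iterate_mem_of_mem_radical {R H : Type*} [CommRing R] [AddCommGroup H] [Module R H]
    {p : ℕ} (hp : p.Prime) {ξ : H → H} (hsemi : ∀ (r : R) (h : H), ξ (r • h) = r ^ p • ξ h)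
    {Γ : Set H} (hΓ : ∀ (j : ℕ) (y : H), ξ^[j] y ∈ Γ → y ∈ Γ) {I : Ideal R} {t : ℕ} {h : H}
    (hI : ∀ c ∈ I, ∀ n : ℕ, t ≤ n → c • ξ^[n] h ∈ Γ) {a : R} (ha : a ∈ I.radical) (n : ℕ) :
    a • ξ^[n] h ∈ Γ := by
  obtain ⟨s, hs⟩ := ha
  have hle : s + t ≤ p ^ (s + t) := (Nat.lt_pow_self hp.one_lt).le
  apply hΓ (s + t)
  rw [iterate_smul_of_pow_semilinear hsemi, ← Function.iterate_add_apply]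
  exact hI _ (I.pow_mem_of_pow_mem hs (by omega)) _ (by omega)


/-- Let `R` be a commutative Noetherian ring of prime characteristic `p`,
let `H` be an `R`-module with Frobenius-semilinear endomorphism `ξ`, and let `m₀ ∈ ℕ` be
such that `ξ^{m₀} h = 0` for all `h ∈ Γ_x(H)`.  Let `𝔠` be an ideal of `R` and `t₀ ∈ ℕ`.
Then the set `A := {h ∈ H : c^{p^{m₀}} • ξ^n h = 0 for all c ∈ 𝔠 and all n ≥ m₀ + t₀}`
is an `R`-submodule of `H`, stable under `ξ`, containing `Γ_x(H)`; moreover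
`A = {h : c • ξ^n h ∈ Γ_x(H) for all c ∈ 𝔠, n ≥ t₀}`
`  = {h : a • ξ^n h ∈ Γ_x(H) for all a ∈ √𝔠, n ∈ ℕ}`
`  = {h : a^{p^{m₀}} • ξ^n h = 0 for all a ∈ √𝔠, n ≥ m₀}`. -/
theorem stmt9 (R : Type*) [CommRing R] [IsNoetherianRing R]
    (p : ℕ) (hp : p.Prime) [CharP R p]
    (H : Type*) [AddCommGroup H] [Module R H]
    (ξ : H → H)
    (hadd : ∀ a b : H, ξ (a + b) = ξ a + ξ b)
    (hsemi : ∀ (r : R) (h : H), ξ (r • h) = r ^ p • ξ h)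
    (Γ : Set H) (hΓ : Γ = {h : H | ∃ j : ℕ, 0 < j ∧ ξ^[j] h = 0})
    (m₀ : ℕ) (hm₀ : ∀ h ∈ Γ, ξ^[m₀] h = 0)
    (𝔠 : Ideal R) (t₀ : ℕ)
    (A : Set H)
    (hA : A = {h : H | ∀ c ∈ 𝔠, ∀ n : ℕ, m₀ + t₀ ≤ n → c ^ p ^ m₀ • ξ^[n] h = 0}) :
    (0 : H) ∈ A ∧
    (∀ h₁ h₂ : H, h₁ ∈ A → h₂ ∈ A → h₁ + h₂ ∈ A) ∧
    (∀ (r : R) (h : H), h ∈ A → r • h ∈ A) ∧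
    (∀ h : H, h ∈ A → ξ h ∈ A) ∧
    Γ ⊆ A ∧
    A = {h : H | ∀ c ∈ 𝔠, ∀ n : ℕ, t₀ ≤ n → c • ξ^[n] h ∈ Γ} ∧
    A = {h : H | ∀ a ∈ 𝔠.radical, ∀ n : ℕ, a • ξ^[n] h ∈ Γ} ∧
    A = {h : H | ∀ a ∈ 𝔠.radical, ∀ n : ℕ, m₀ ≤ n → a ^ p ^ m₀ • ξ^[n] h = 0} := by
  have h0 := iterate_map_zero_of_additive hadd
  have hs := iterate_smul_of_pow_semilinear hsemi
  have hvanish : ∀ {y : H} {m n : ℕ}, m ≤ n → ξ^[m] y = 0 → ξ^[n] y = 0 := by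
    intro y m n hmn hy
    rw [← Nat.sub_add_cancel hmn, Function.iterate_add_apply, hy, h0]
  have mem_iff : ∀ y : H, y ∈ Γ ↔ ξ^[m₀] y = 0 := by
    refine fun y => ⟨hm₀ y, fun hy => ?_⟩
    rw [hΓ]
    exact ⟨m₀ + 1, m₀.succ_pos, hvanish m₀.le_succ hy⟩
  have mem_of_iterate : ∀ (j : ℕ) (y : H), ξ^[j] y ∈ Γ → y ∈ Γ := by
    intro j y hy
    rw [hΓ] at hy ⊢
    obtain ⟨i, hi, hy⟩ := hy
    exact ⟨i + j, by omega, by rw [Function.iterate_add_apply, hy]⟩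
  have smul_mem_iff : ∀ (c : R) (n : ℕ) (h : H),
      c • ξ^[n] h ∈ Γ ↔ c ^ p ^ m₀ • ξ^[m₀ + n] h = 0 := by
    intro c n h
    rw [mem_iff, hs, Function.iterate_add_apply]
  have hB : A = {h : H | ∀ c ∈ 𝔠, ∀ n : ℕ, t₀ ≤ n → c • ξ^[n] h ∈ Γ} := by
    rw [hA]
    ext h
    refine ⟨fun hh c hc n hn => (smul_mem_iff c n h).2 (hh c hc _ (by omega)),
      fun hh c hc n hn => ?_⟩
    obtain ⟨k, rfl⟩ := Nat.exists_eq_add_of_le (show m₀ ≤ n by omega)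
    exact (smul_mem_iff c k h).1 (hh c hc k (by omega))
  have hC : A = {h : H | ∀ a ∈ 𝔠.radical, ∀ n : ℕ, a • ξ^[n] h ∈ Γ} := by
    rw [hB]
    ext h
    exact ⟨fun hh a ha n => smul_iterate_mem_of_mem_radical hp hsemi mem_of_iterate hh ha n,
      fun hh c hc n _ => hh c (Ideal.le_radical hc) n⟩
  refine ⟨?_, ?_, ?_, ?_, ?_, hB, hC, ?_⟩
  · rw [hA]
    intro c _ n _
    rw [h0, smul_zero]
  · rw [hA]
    intro h₁ h₂ hh₁ hh₂ c hc n hn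
    rw [iterate_map_add_of_additive hadd, smul_add, hh₁ c hc n hn, hh₂ c hc n hn, add_zero]
  · rw [hA]
    intro r h hh c hc n hn
    rw [hs, smul_comm, hh c hc n hn, smul_zero]
  · rw [hA]
    intro h hh c hc n hn
    rw [← Function.iterate_succ_apply]
    exact hh c hc _ (by omega)
  · rw [hA]
    intro h hh c _ n hn
    rw [hvanish (by omega) (hm₀ h hh), smul_zero]
  · rw [hC]
    ext h
    refine ⟨fun hh a ha n hn => ?_, fun hh a ha n => (smul_mem_iff a n h).2 (hh a ha _ (by omega))⟩
    obtain ⟨k, rfl⟩ := Nat.exists_eq_add_of_le hn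
    exact (smul_mem_iff a k h).1 (hh a ha k)
end

section
/- Let R be a commutative Noetherian ring of prime characteristic p, let H be an R-module with Frobenius-semilinear endomorphism ξ, and let 𝔠 be an ideal of R. Suppose m₀ ∈ ℕ satisfies ξ^{m₀}(h) = 0 for all h ∈ Γ_x(H), and suppose v₀ ∈ ℕ has the property that for every h ∈ H: if c·ξ^{n₁}(h) ∈ Γ_x(H) for all c ∈ 𝔠 for one single n₁ ≥ v₀, then c·ξ^n(h) ∈ Γ_x(H) for all c ∈ 𝔠 and all n ∈ ℕ (i.e., v₀ is at least the 𝔠-stability index of the x-torsion-free module H/Γ_x(H)). Then for h ∈ H the following are equivalent: (i) there exists one single integer n₁ ≥ m₀ + v₀ such that c^{p^{m₀}}·ξ^{n₁}(h) = 0 for all c ∈ 𝔠; (ii) c^{p^{m₀}}·ξ^n(h) = 0 for all c ∈ 𝔠 and all n ≥ m₀. -/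
/-- The `m`-th iterate of a `p`-semilinear map is `p ^ m`-semilinear. -/
theorem iterate_smul_of_semilinear_s10 {R H : Type*} [Monoid R] [SMul R H] {p : ℕ} {ξ : H → H}
    (hsemi : ∀ (r : R) (h : H), ξ (r • h) = r ^ p • ξ h) (m : ℕ) (r : R) (h : H) :
    ξ^[m] (r • h) = r ^ p ^ m • ξ^[m] h := by
  induction m with
  | zero => simp
  | succ m ih => rw [Function.iterate_succ_apply', ih, hsemi, Function.iterate_succ_apply',
      ← pow_mul, ← pow_succ]

/-- Let `R` be a commutative Noetherian ring of prime characteristic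
`p`, let `H` be an `R`-module with Frobenius-semilinear endomorphism `ξ`, and let `𝔠` be
an ideal of `R`.  Suppose `m₀ ∈ ℕ` satisfies `ξ^{m₀} h = 0` for all `h ∈ Γ_x(H)`, and
suppose `v₀ ∈ ℕ` has the property that for every `h ∈ H`: if `c • ξ^{n₁} h ∈ Γ_x(H)` for
all `c ∈ 𝔠` for one single `n₁ ≥ v₀`, then `c • ξ^n h ∈ Γ_x(H)` for all `c ∈ 𝔠` and all
`n ∈ ℕ`.  Then for `h ∈ H` the following are equivalent:
(i) there exists one single integer `n₁ ≥ m₀ + v₀` such that `c^{p^{m₀}} • ξ^{n₁} h = 0`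
for all `c ∈ 𝔠`; (ii) `c^{p^{m₀}} • ξ^n h = 0` for all `c ∈ 𝔠` and all `n ≥ m₀`. -/
theorem stmt10 (R : Type*) [CommRing R] [IsNoetherianRing R]
    (p : ℕ) (hp : p.Prime) [CharP R p]
    (H : Type*) [AddCommGroup H] [Module R H]
    (ξ : H → H)
    (hadd : ∀ a b : H, ξ (a + b) = ξ a + ξ b)
    (hsemi : ∀ (r : R) (h : H), ξ (r • h) = r ^ p • ξ h)
    (Γ : Set H) (hΓ : Γ = {h : H | ∃ j : ℕ, 0 < j ∧ ξ^[j] h = 0})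
    (𝔠 : Ideal R)
    (m₀ : ℕ) (hm₀ : ∀ h ∈ Γ, ξ^[m₀] h = 0)
    (v₀ : ℕ)
    (hv₀ : ∀ h : H, ∀ n₁ : ℕ, v₀ ≤ n₁ → (∀ c ∈ 𝔠, c • ξ^[n₁] h ∈ Γ) →
      ∀ n : ℕ, ∀ c ∈ 𝔠, c • ξ^[n] h ∈ Γ)
    (h : H) :
    (∃ n₁ : ℕ, m₀ + v₀ ≤ n₁ ∧ ∀ c ∈ 𝔠, c ^ p ^ m₀ • ξ^[n₁] h = 0) ↔
    (∀ n : ℕ, m₀ ≤ n → ∀ c ∈ 𝔠, c ^ p ^ m₀ • ξ^[n] h = 0) := by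
  have key (k : ℕ) (c : R) : ξ^[m₀] (c • ξ^[k] h) = c ^ p ^ m₀ • ξ^[m₀ + k] h := by
    rw [iterate_smul_of_semilinear_s10 hsemi, Function.iterate_add_apply]
  constructor
  · rintro ⟨n₁, hn₁, hc⟩ n hn c hcmem
    obtain ⟨k, rfl⟩ := Nat.exists_eq_add_of_le (show m₀ ≤ n₁ by omega)
    obtain ⟨l, rfl⟩ := Nat.exists_eq_add_of_le hn
    have hξ0 : ξ 0 = 0 := by simpa using hadd 0 0
    rw [← key]
    refine hm₀ _ (hv₀ h k (by omega) (fun d hd => ?_) l c hcmem)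
    rw [hΓ]
    exact ⟨m₀ + 1, m₀.succ_pos, by rw [Function.iterate_succ_apply', key, hc d hd, hξ0]⟩
  · exact fun hall => ⟨m₀ + v₀, le_rfl, hall _ (Nat.le_add_right _ _)⟩
end
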